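/- arXiv:1703.09530 — 7 statements merged into one kernel-verified Lean document; each statement's English description precedes it below -/
import Mathlib

section
/- (Wasow's criterion) Let Ω ⊆ ℂ^N be open, let A, B : Ω → Mat(n×n, ℂ) be holomorphic, let ξ ∈ Ω, and let Φ ∈ Mat(n×n, ℂ) satisfy Φ B(ξ) = A(ξ) Φ. Suppose the dimension of the complex vector space {Θ ∈ Mat(n×n, ℂ) : Θ B(ζ) = A(ζ) Θ} is constant for ζ in some neighborhood of ξ. Then there exist an open neighborhood U ⊆ Ω of ξ and a holomorphic map H : U → Mat(n×n, ℂ) such that H(ζ) B(ζ) = A(ζ) H(ζ) for all ζ ∈ U and H(ξ) = Φ. -/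
/-- A matrix-valued map is holomorphic on a set if each entry is
complex-differentiable on that set. -/
def MatHoloOn {E : Type*} [NormedAddCommGroup E] [NormedSpace ℂ E] {n m : ℕ}
    (f : E → Matrix (Fin n) (Fin m) ℂ) (s : Set E) : Prop :=
  ∀ i j, DifferentiableOn ℂ (fun ζ => f ζ i j) s

/-- The complex vector space `{Θ | Θ * Q = P * Θ}` of intertwiners of two matrices. -/
noncomputable def intertwiners (n : ℕ) (P Q : Matrix (Fin n) (Fin n) ℂ) :
    Submodule ℂ (Matrix (Fin n) (Fin n) ℂ) where
  carrier := {Θ | Θ * Q = P * Θ}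
  add_mem' := by
    intro a b ha hb
    simp only [Set.mem_setOf_eq] at *
    rw [add_mul, mul_add, ha, hb]
  zero_mem' := by simp
  smul_mem' := by
    intro c a ha
    simp only [Set.mem_setOf_eq] at *
    rw [smul_mul_assoc, mul_smul_comm, ha]

/-- Every linear map between vector spaces has a generalized inverse. -/
theorem LinearMap.exists_generalized_inverse {k E F : Type*} [Field k]
    [AddCommGroup E] [Module k E] [AddCommGroup F] [Module k F] (f : E →ₗ[k] F) :
    ∃ g : F →ₗ[k] E, ∀ x, f (g (f x)) = f x := by
  obtain ⟨s, hs⟩ := f.rangeRestrict.exists_rightInverse_of_surjective f.range_rangeRestrict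
  obtain ⟨g, hg⟩ := s.exists_extend
  refine ⟨g, fun x => ?_⟩
  have h₁ : g (f x) = s (f.rangeRestrict x) := LinearMap.congr_fun hg (f.rangeRestrict x)
  have h₂ := LinearMap.congr_fun hs (f.rangeRestrict x)
  rw [h₁]
  exact congrArg Subtype.val h₂

/-- A family of continuous linear maps on a finite-dimensional space is differentiable if it is so
pointwise. -/
theorem DifferentiableOn.of_clm_apply {𝕜 X E F : Type*} [NontriviallyNormedField 𝕜]
    [CompleteSpace 𝕜] [NormedAddCommGroup X] [NormedSpace 𝕜 X]
    [NormedAddCommGroup E] [NormedSpace 𝕜 E] [FiniteDimensional 𝕜 E]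
    [NormedAddCommGroup F] [NormedSpace 𝕜 F] {f : X → E →L[𝕜] F} {s : Set X}
    (hf : ∀ x, DifferentiableOn 𝕜 (fun ζ => f ζ x) s) : DifferentiableOn 𝕜 f s := by
  let d := Module.finrank 𝕜 E
  have hd : d = Module.finrank 𝕜 (Fin d → 𝕜) := (Module.finrank_fin_fun 𝕜).symm
  let e₁ := ContinuousLinearEquiv.ofFinrankEq hd
  let e₂ := (e₁.arrowCongr (1 : F ≃L[𝕜] F)).trans (ContinuousLinearEquiv.piRing (Fin d))
  rw [← e₂.comp_differentiableOn_iff]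
  exact differentiableOn_pi.2 fun i => hf _

/-- If `ker (L ζ)` has constant dimension near `ξ`, every vector of `ker (L ξ)` extends to a local
holomorphic family of vectors of `ker (L ζ)`. -/
theorem exists_differentiableOn_mem_ker {X E F : Type*}
    [NormedAddCommGroup X] [NormedSpace ℂ X]
    [NormedAddCommGroup E] [NormedSpace ℂ E] [FiniteDimensional ℂ E]
    [NormedAddCommGroup F] [NormedSpace ℂ F] [FiniteDimensional ℂ F]
    {V : Set X} (hV : IsOpen V) {L : X → E →ₗ[ℂ] F}
    (hL : ∀ x, DifferentiableOn ℂ (fun ζ => L ζ x) V)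
    {ξ : X} (hξ : ξ ∈ V) {r : ℕ} (hr : ∀ ζ ∈ V, Module.finrank ℂ (LinearMap.ker (L ζ)) = r)
    {v : E} (hv : L ξ v = 0) :
    ∃ U : Set X, IsOpen U ∧ ξ ∈ U ∧ U ⊆ V ∧
      ∃ h : X → E, DifferentiableOn ℂ h U ∧ (∀ ζ ∈ U, L ζ (h ζ) = 0) ∧ h ξ = v := by
  have : CompleteSpace E := FiniteDimensional.complete ℂ E
  obtain ⟨g, hg⟩ := (L ξ).exists_generalized_inverse
  -- The map `T ζ` is invertible near `ξ` and sends `ker (L ζ)` into `ker (L ξ)`.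
  set T : X → E →L[ℂ] E := fun ζ =>
    LinearMap.toContinuousLinearMap (LinearMap.id + g ∘ₗ (L ζ - L ξ)) with hT
  have hTd : DifferentiableOn ℂ T V := by
    refine DifferentiableOn.of_clm_apply fun x => DifferentiableOn.const_add x ?_
    exact (LinearMap.toContinuousLinearMap g).differentiable.comp_differentiableOn
      ((hL x).sub_const _)
  have hTξ : T ξ = 1 := by ext; simp [hT]
  have hTker : ∀ ζ x, L ζ x = 0 → L ξ (T ζ x) = 0 := fun ζ x hx => by simp [hT, hx, hg]
  refine ⟨V ∩ T ⁻¹' {x | IsUnit x}, hTd.continuousOn.isOpen_inter_preimage hV Units.isOpen,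
    ⟨hξ, by simp [hTξ]⟩, Set.inter_subset_left, fun ζ => Ring.inverse (T ζ) v, ?_, ?_,
    by simp [hTξ]⟩
  · exact ((hTd.mono Set.inter_subset_left).inverse fun ζ hζ => hζ.2).clm_apply
      (differentiableOn_const v)
  · rintro ζ ⟨hζV, hζ : IsUnit (T ζ)⟩
    have hinv : ∀ x, Ring.inverse (T ζ) (T ζ x) = x := fun x =>
      DFunLike.congr_fun (Ring.inverse_mul_cancel _ hζ) x
    have hmap : (LinearMap.ker (L ζ)).map (T ζ : E →ₗ[ℂ] E) = LinearMap.ker (L ξ) := by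
      refine Submodule.eq_of_le_of_finrank_eq ?_ ?_
      · rintro _ ⟨x, hx, rfl⟩
        exact hTker ζ x hx
      · rw [← (Submodule.equivMapOfInjective (T ζ : E →ₗ[ℂ] E)
          (Function.LeftInverse.injective hinv) _).finrank_eq, hr ζ hζV, hr ξ hξ]
    obtain ⟨x, hx, rfl⟩ : v ∈ (LinearMap.ker (L ζ)).map (T ζ : E →ₗ[ℂ] E) :=
      hmap ▸ hv
    change L ζ (Ring.inverse (T ζ) (T ζ x)) = 0
    rw [hinv]
    exact hx

attribute [local instance] Matrix.normedAddCommGroup Matrix.normedSpace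

/-- Entrywise holomorphy agrees with complex differentiability for the sup norm on matrices. -/
theorem matHoloOn_iff_differentiableOn {E : Type*} [NormedAddCommGroup E] [NormedSpace ℂ E]
    {n m : ℕ} {f : E → Matrix (Fin n) (Fin m) ℂ} {s : Set E} :
    MatHoloOn f s ↔ DifferentiableOn ℂ f s :=
  Iff.symm <| (differentiableOn_pi (Φ := f)).trans <| forall_congr' fun i =>
    differentiableOn_pi (Φ := fun ζ => f ζ i)

/-- Wasow's criterion: if the dimension of the space of intertwiners of `B ζ` and `A ζ`
is constant near `ξ`, then any intertwiner `Φ` of `B ξ` and `A ξ` extends to a local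
holomorphic family of intertwiners. -/
theorem wasow_criterion (N n : ℕ) (Ω : Set (Fin N → ℂ)) (hΩ : IsOpen Ω)
    (A B : (Fin N → ℂ) → Matrix (Fin n) (Fin n) ℂ)
    (hA : MatHoloOn A Ω) (hB : MatHoloOn B Ω)
    (ξ : Fin N → ℂ) (hξ : ξ ∈ Ω)
    (Φ : Matrix (Fin n) (Fin n) ℂ) (hΦ : Φ * B ξ = A ξ * Φ)
    (hconst : ∃ V : Set (Fin N → ℂ), IsOpen V ∧ ξ ∈ V ∧ V ⊆ Ω ∧ ∃ r : ℕ,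
      ∀ ζ ∈ V, Module.finrank ℂ (intertwiners n (A ζ) (B ζ)) = r) :
    ∃ U : Set (Fin N → ℂ), IsOpen U ∧ ξ ∈ U ∧ U ⊆ Ω ∧
      ∃ H : (Fin N → ℂ) → Matrix (Fin n) (Fin n) ℂ, MatHoloOn H U ∧
        (∀ ζ ∈ U, H ζ * B ζ = A ζ * H ζ) ∧ H ξ = Φ := by
  obtain ⟨V, hV, hξV, hVΩ, r, hr⟩ := hconst
  let M := Matrix (Fin n) (Fin n) ℂ
  let L : (Fin N → ℂ) → M →ₗ[ℂ] M := fun ζ =>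
    LinearMap.mulRight ℂ (B ζ) - LinearMap.mulLeft ℂ (A ζ)
  have hL : ∀ Θ, DifferentiableOn ℂ (fun ζ => L ζ Θ) V := fun Θ =>
    matHoloOn_iff_differentiableOn.1 fun i j => by
      change DifferentiableOn ℂ (fun ζ => ∑ k, Θ i k * B ζ k j - ∑ k, A ζ i k * Θ k j) V
      exact (DifferentiableOn.fun_sum fun k _ => ((hB k j).mono hVΩ).const_mul _).sub
        (DifferentiableOn.fun_sum fun k _ => ((hA i k).mono hVΩ).mul_const _)
  have hL_iff : ∀ ζ Θ, L ζ Θ = 0 ↔ Θ * B ζ = A ζ * Θ := fun ζ Θ => sub_eq_zero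
  have hker : ∀ ζ, LinearMap.ker (L ζ) = intertwiners n (A ζ) (B ζ) :=
    fun ζ => Submodule.ext (hL_iff ζ)
  obtain ⟨U, hU, hξU, hUV, H, hH, hHL, hHξ⟩ := exists_differentiableOn_mem_ker hV hL hξV
    (fun ζ hζ => by rw [hker, hr ζ hζ]) ((hL_iff ξ Φ).2 hΦ)
  exact ⟨U, hU, hξU, hUV.trans hVΩ, H, matHoloOn_iff_differentiableOn.2 hH,
    fun ζ hζ => (hL_iff ζ _).1 (hHL ζ hζ), hHξ⟩
end

section
/- (Smith's criterion) Let Ω ⊆ ℂ be open, let A, B : Ω → Mat(n×n, ℂ) be holomorphic, let ξ ∈ Ω, and let Φ ∈ Mat(n×n, ℂ). Suppose there exist an open neighborhood V ⊆ Ω of ξ and a continuous map C : V → GL(n, ℂ) such that C(ζ) B(ζ) = A(ζ) C(ζ) for all ζ ∈ V and C(ξ) = Φ. Then there exist an open neighborhood U ⊆ V of ξ and a holomorphic map H : U → Mat(n×n, ℂ) such that H(ζ) B(ζ) = A(ζ) H(ζ) for all ζ ∈ U and H(ξ) = Φ. -/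
open Filter Topology in
/-- Near `ξ`, a continuous solution of a homogeneous linear system with analytic coefficients can
be replaced by an analytic solution with the same value at `ξ`. -/
theorem exists_analyticAt_sum_mul_eq_zero_fin {ι : Type*} {ξ : ℂ} (q : ℕ)
    (M : ι → Fin q → ℂ → ℂ) (hM : ∀ i j, AnalyticAt ℂ (M i j) ξ)
    (c : Fin q → ℂ → ℂ) (hc : ∀ j, ContinuousAt (c j) ξ)
    (hMc : ∀ i, ∀ᶠ ζ in 𝓝[≠] ξ, ∑ j, M i j ζ * c j ζ = 0) :
    ∃ h : Fin q → ℂ → ℂ, (∀ j, AnalyticAt ℂ (h j) ξ) ∧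
      (∀ i, ∀ᶠ ζ in 𝓝[≠] ξ, ∑ j, M i j ζ * h j ζ = 0) ∧ ∀ j, h j ξ = c j ξ := by
  induction q with
  | zero => exact ⟨c, fun j => j.elim0, hMc, fun j => j.elim0⟩
  | succ q ih =>
    by_cases hzero : ∀ i j, analyticOrderAt (M i j) ξ = ⊤
    · refine ⟨fun j _ => c j ξ, fun j => analyticAt_const, fun i => ?_, fun j => rfl⟩
      have hall : ∀ᶠ ζ in 𝓝[≠] ξ, ∀ j, M i j ζ = 0 :=
        eventually_all.2 fun j =>
          (analyticOrderAt_eq_top.1 (hzero i j)).filter_mono nhdsWithin_le_nhds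
      filter_upwards [hall] with ζ hζ
      simp [hζ]
    · push Not at hzero
      obtain ⟨i₀, j₁, hj₁⟩ := hzero
      obtain ⟨p, hp⟩ := Finite.exists_min fun j => analyticOrderAt (M i₀ j) ξ
      obtain ⟨d, hd⟩ := ENat.ne_top_iff_exists.1 (ne_top_of_le_ne_top hj₁ (hp j₁))
      have hdiv : ∀ j, ∃ g : ℂ → ℂ, AnalyticAt ℂ g ξ ∧ (j = p → g ξ ≠ 0) ∧
          ∀ᶠ ζ in 𝓝 ξ, M i₀ j ζ = (ζ - ξ) ^ d • g ζ := by
        intro j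
        by_cases hj : j = p
        · subst hj
          obtain ⟨g, hg, hg0, he⟩ := (hM i₀ j).analyticOrderAt_eq_natCast.1 hd.symm
          exact ⟨g, hg, fun _ => hg0, he⟩
        · obtain ⟨g, hg, he⟩ := (natCast_le_analyticOrderAt (hM i₀ j)).1 (hd.trans_le (hp j))
          exact ⟨g, hg, fun h => absurd h hj, he⟩
      choose g hg hg0 hMg using hdiv
      have hgp : g p ξ ≠ 0 := hg0 p rfl
      let r : Fin q → ℂ → ℂ := fun j ζ => -(g (p.succAbove j) ζ / g p ζ)
      have hr : ∀ j, AnalyticAt ℂ (r j) ξ := fun j => ((hg _).div (hg p) hgp).neg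
      have hcp : ∀ᶠ ζ in 𝓝[≠] ξ, c p ζ = ∑ j, r j ζ * c (p.succAbove j) ζ := by
        filter_upwards [hMc i₀, self_mem_nhdsWithin,
          (eventually_all.2 hMg).filter_mono nhdsWithin_le_nhds,
          ((hg p).continuousAt.eventually_ne hgp).filter_mono nhdsWithin_le_nhds]
          with ζ hζ hne hfac hgζ
        have hpow : (ζ - ξ) ^ d ≠ 0 := pow_ne_zero _ (sub_ne_zero.2 hne)
        simp only [hfac, smul_eq_mul, mul_assoc, ← Finset.mul_sum] at hζ
        have hsum := (mul_eq_zero.1 hζ).resolve_left hpow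
        rw [Fin.sum_univ_succAbove _ p] at hsum
        have : c p ζ = -(∑ j, g (p.succAbove j) ζ * c (p.succAbove j) ζ) / g p ζ := by
          rw [eq_div_iff hgζ]
          linear_combination hsum
        rw [this, neg_div, Finset.sum_div, ← Finset.sum_neg_distrib]
        refine Finset.sum_congr rfl fun j _ => ?_
        simp only [r]
        ring
      have hcpξ : c p ξ = ∑ j, r j ξ * c (p.succAbove j) ξ := by
        have hcont : ContinuousAt (fun ζ => ∑ j, r j ζ * c (p.succAbove j) ζ) ξ :=
          tendsto_finsetSum _ fun j _ => (hr j).continuousAt.mul (hc _)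
        exact tendsto_nhds_unique_of_eventuallyEq ((hc p).tendsto.mono_left nhdsWithin_le_nhds)
          (hcont.tendsto.mono_left nhdsWithin_le_nhds) hcp
      have hsubst : ∀ i ζ (x : Fin q → ℂ),
          ∑ j, (M i (p.succAbove j) ζ + M i p ζ * r j ζ) * x j =
            M i p ζ * ∑ j, r j ζ * x j + ∑ j, M i (p.succAbove j) ζ * x j := by
        intro i ζ x
        rw [Finset.mul_sum, ← Finset.sum_add_distrib]
        exact Finset.sum_congr rfl fun j _ => by ring
      obtain ⟨h, hh, hMh, hhξ⟩ := ih
        (fun i j ζ => M i (p.succAbove j) ζ + M i p ζ * r j ζ)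
        (fun i j => (hM _ _).add ((hM _ _).mul (hr j)))
        (fun j => c (p.succAbove j)) (fun j => hc _) fun i => by
          filter_upwards [hMc i, hcp] with ζ hζ hcζ
          rw [hsubst, ← hcζ, ← Fin.sum_univ_succAbove (fun j => M i j ζ * c j ζ) p, hζ]
      refine ⟨p.insertNth (fun ζ => ∑ j, r j ζ * h j ζ) h, ?_, fun i => ?_, ?_⟩
      · rw [Fin.forall_iff_succAbove p]
        simp only [Fin.insertNth_apply_same, Fin.insertNth_apply_succAbove]
        exact ⟨Finset.analyticAt_fun_sum _ fun j _ => (hr j).mul (hh j), hh⟩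
      · filter_upwards [hMh i] with ζ hζ
        rw [Fin.sum_univ_succAbove _ p]
        simpa only [Fin.insertNth_apply_same, Fin.insertNth_apply_succAbove, hsubst] using hζ
      · rw [Fin.forall_iff_succAbove p]
        simp only [Fin.insertNth_apply_same, Fin.insertNth_apply_succAbove, hhξ, hcpξ,
          implies_true, and_self]

open Filter Topology in
/-- Near `ξ`, a continuous solution of a homogeneous linear system with analytic coefficients and
finitely many unknowns can be replaced by an analytic solution with the same value at `ξ`. -/
theorem exists_analyticAt_sum_mul_eq_zero {ι κ : Type*} [Fintype κ] {ξ : ℂ}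
    (M : ι → κ → ℂ → ℂ) (hM : ∀ i j, AnalyticAt ℂ (M i j) ξ)
    (c : κ → ℂ → ℂ) (hc : ∀ j, ContinuousAt (c j) ξ)
    (hMc : ∀ i, ∀ᶠ ζ in 𝓝[≠] ξ, ∑ j, M i j ζ * c j ζ = 0) :
    ∃ h : κ → ℂ → ℂ, (∀ j, AnalyticAt ℂ (h j) ξ) ∧
      (∀ i, ∀ᶠ ζ in 𝓝 ξ, ∑ j, M i j ζ * h j ζ = 0) ∧ ∀ j, h j ξ = c j ξ := by
  let e := Fintype.equivFin κ
  obtain ⟨h, hh, hMh, hhξ⟩ := exists_analyticAt_sum_mul_eq_zero_fin (Fintype.card κ)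
    (fun i j => M i (e.symm j)) (fun i j => hM _ _) (fun j => c (e.symm j)) (fun j => hc _)
    fun i => by
      filter_upwards [hMc i] with ζ hζ
      rw [← hζ]
      exact e.symm.sum_comp fun j => M i j ζ * c j ζ
  refine ⟨fun j => h (e j), fun j => hh _, fun i => ?_, fun j => by simp [hhξ]⟩
  have han : AnalyticAt ℂ (fun ζ => ∑ j, M i j ζ * h (e j) ζ) ξ :=
    Finset.analyticAt_fun_sum _ fun j _ => (hM i j).mul (hh _)
  refine han.frequently_zero_iff_eventually_zero.1 (Eventually.frequently ?_)
  filter_upwards [hMh i] with ζ hζ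
  rw [← hζ, ← e.symm.sum_comp]
  simp

/-- The equation `X * B = A * X` written as a linear system in the entries of `X`. -/
theorem Matrix.sum_mul_eq_mul_sub_mul_apply {n R : Type*} [Fintype n] [DecidableEq n] [CommRing R]
    (A B X : Matrix n n R) (i k : n) :
    ∑ p : n × n, ((if p.1 = i then B p.2 k else 0) - (if p.2 = k then A i p.1 else 0)) * X p.1 p.2 =
      (X * B) i k - (A * X) i k := by
  simp only [sub_mul, Finset.sum_sub_distrib, Fintype.sum_prod_type, Matrix.mul_apply, ite_mul,
    zero_mul, Finset.sum_ite_eq', Finset.mem_univ, if_true]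
  congr 1
  rw [Finset.sum_comm]
  simp [mul_comm]


/-- Smith's criterion: in one variable, a continuous invertible intertwiner of two
holomorphic matrices can locally be replaced by a holomorphic intertwiner with the
same value at the given point. -/
theorem smith_criterion (n : ℕ) (Ω : Set ℂ) (hΩ : IsOpen Ω)
    (A B : ℂ → Matrix (Fin n) (Fin n) ℂ)
    (hA : MatHoloOn A Ω) (hB : MatHoloOn B Ω)
    (ξ : ℂ) (hξ : ξ ∈ Ω)
    (Φ : Matrix (Fin n) (Fin n) ℂ)
    (V : Set ℂ) (hV : IsOpen V) (hξV : ξ ∈ V) (hVΩ : V ⊆ Ω)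
    (C : ℂ → Matrix (Fin n) (Fin n) ℂ)
    (hCcont : ∀ i j, ContinuousOn (fun ζ => C ζ i j) V)
    (hCunit : ∀ ζ ∈ V, IsUnit (C ζ))
    (hCint : ∀ ζ ∈ V, C ζ * B ζ = A ζ * C ζ)
    (hCξ : C ξ = Φ) :
    ∃ U : Set ℂ, IsOpen U ∧ ξ ∈ U ∧ U ⊆ V ∧
      ∃ H : ℂ → Matrix (Fin n) (Fin n) ℂ, MatHoloOn H U ∧
        (∀ ζ ∈ U, H ζ * B ζ = A ζ * H ζ) ∧ H ξ = Φ := by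
  have hΩξ : Ω ∈ nhds ξ := hΩ.mem_nhds hξ
  have hVξ : V ∈ nhds ξ := hV.mem_nhds hξV
  obtain ⟨h, hh, hMh, hhξ⟩ := exists_analyticAt_sum_mul_eq_zero (ξ := ξ)
    (fun (i p : Fin n × Fin n) ζ =>
      (if p.1 = i.1 then B ζ p.2 i.2 else 0) - (if p.2 = i.2 then A ζ i.1 p.1 else 0))
    (fun i p => by
      have hAan := (hA i.1 p.1).analyticAt hΩξ
      have hBan := (hB p.2 i.2).analyticAt hΩξ
      refine AnalyticAt.fun_sub ?_ ?_
      · split_ifs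
        exacts [hBan, analyticAt_const]
      · split_ifs
        exacts [hAan, analyticAt_const])
    (fun p ζ => C ζ p.1 p.2) (fun p => (hCcont p.1 p.2).continuousAt hVξ)
    (fun i => by
      filter_upwards [mem_nhdsWithin_of_mem_nhds hVξ] with ζ hζ
      rw [Matrix.sum_mul_eq_mul_sub_mul_apply, hCint ζ hζ, sub_self])
  obtain ⟨U, hU, hUo, hξU⟩ := eventually_nhds_iff.1
    ((Filter.eventually_all.2 hMh).and
      ((Filter.eventually_all.2 fun p => (hh p).eventually_analyticAt).and hVξ))
  refine ⟨U, hUo, hξU, fun ζ hζ => (hU ζ hζ).2.2, fun ζ => Matrix.of fun i j => h (i, j) ζ,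
    fun i j ζ hζ => ((hU ζ hζ).2.1 (i, j)).differentiableAt.differentiableWithinAt,
    fun ζ hζ => ?_, ?_⟩
  · ext i k
    rw [← sub_eq_zero, ← Matrix.sum_mul_eq_mul_sub_mul_apply]
    exact (hU ζ hζ).1 (i, k)
  · ext i j
    rw [← hCξ]
    exact hhξ (i, j)
end

section
/- (Spallek's criterion) Let Ω ⊆ ℂ^N be open, let A, B : Ω → Mat(n×n, ℂ) be holomorphic, let ξ ∈ Ω, and let Φ ∈ Mat(n×n, ℂ). Suppose there exist an open neighborhood V ⊆ Ω of ξ and an infinitely real-differentiable map T : V → Mat(n×n, ℂ) such that T(ζ) B(ζ) = A(ζ) T(ζ) for all ζ ∈ V and T(ξ) = Φ. Then there exist an open neighborhood U ⊆ V of ξ and a holomorphic map H : U → Mat(n×n, ℂ) such that H(ζ) B(ζ) = A(ζ) H(ζ) for all ζ ∈ U and H(ξ) = Φ. -/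
/-- Triangular systems with small off-diagonal part are solvable in weighted `ℓ¹`. -/
theorem exists_triangular_solution {J : Type*} (W : J → ℕ) (hW : Function.Injective W)
    (u : J → ℝ) (hu : ∀ j, 0 ≤ u j) (v : J → J → ℂ) (hv : ∀ γ δ, v γ δ ≠ 0 → W γ < W δ)
    (hvs : ∀ γ, Summable fun δ => ‖v γ δ‖ * u δ)
    (hvb : ∀ γ, ∑' δ, ‖v γ δ‖ * u δ ≤ u γ / 2)
    (F : J → ℂ) (hF : Summable fun δ => ‖F δ‖ * u δ) :
    ∃ h : J → ℂ, (Summable fun δ => ‖h δ‖ * u δ) ∧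
      ∀ (δ : J) (s : Finset J), (∀ γ, W γ < W δ → γ ∈ s) → F δ = h δ + ∑ γ ∈ s, h γ * v γ δ := by
  classical
  have hfin : ∀ n, {γ | W γ < n}.Finite := fun n =>
    (Set.finite_Iio n).preimage hW.injOn
  let L : ℕ → Finset J := fun n => (hfin n).toFinset
  have hL : ∀ n γ, γ ∈ L n ↔ W γ < n := fun n γ => by simp [L]
  let wf : WellFounded fun a b : J => W a < W b := InvImage.wf W Nat.lt_wfRel.wf
  let h : J → ℂ := wf.fix fun δ ih =>
    F δ - ∑ γ ∈ (L (W δ)).attach, ih γ.1 ((hL _ _).1 γ.2) * v γ.1 δ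
  have hh : ∀ δ, h δ = F δ - ∑ γ ∈ L (W δ), h γ * v γ δ := by
    intro δ
    have := wf.fix_eq (fun δ ih =>
      F δ - ∑ γ ∈ (L (W δ)).attach, ih γ.1 ((hL _ _).1 γ.2) * v γ.1 δ) δ
    rw [← Finset.sum_attach]
    exact this
  refine ⟨h, ?_, fun δ s hs => ?_⟩
  · refine summable_of_sum_le (c := 2 * ∑' δ, ‖F δ‖ * u δ)
      (fun δ => mul_nonneg (norm_nonneg _) (hu _)) fun s => ?_
    obtain ⟨n, hn⟩ : ∃ n, s ⊆ L n := by
      refine ⟨s.sup W + 1, fun γ hγ => (hL _ _).2 (Nat.lt_succ_of_le (Finset.le_sup hγ))⟩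
    have hmono : ∑ δ ∈ s, ‖h δ‖ * u δ ≤ ∑ δ ∈ L n, ‖h δ‖ * u δ :=
      Finset.sum_le_sum_of_subset_of_nonneg hn fun δ _ _ => mul_nonneg (norm_nonneg _) (hu _)
    have h1 : ∑ δ ∈ L n, ‖h δ‖ * u δ ≤
        ∑ δ ∈ L n, ‖F δ‖ * u δ + ∑ δ ∈ L n, ∑ γ ∈ L n, ‖h γ‖ * (‖v γ δ‖ * u δ) := by
      rw [← Finset.sum_add_distrib]
      refine Finset.sum_le_sum fun δ hδ => ?_
      have h2 : ‖h δ‖ ≤ ‖F δ‖ + ∑ γ ∈ L n, ‖h γ‖ * ‖v γ δ‖ := by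
        rw [hh δ]
        refine (norm_sub_le _ _).trans (add_le_add le_rfl ((norm_sum_le _ _).trans ?_))
        simp_rw [norm_mul]
        refine Finset.sum_le_sum_of_subset_of_nonneg (fun γ hγ => ?_) fun _ _ _ => by positivity
        rw [hL] at hγ hδ ⊢
        omega
      calc ‖h δ‖ * u δ ≤ (‖F δ‖ + ∑ γ ∈ L n, ‖h γ‖ * ‖v γ δ‖) * u δ :=
            mul_le_mul_of_nonneg_right h2 (hu _)
        _ = _ := by rw [add_mul, Finset.sum_mul]; simp_rw [mul_assoc]
    have h3 : ∑ δ ∈ L n, ∑ γ ∈ L n, ‖h γ‖ * (‖v γ δ‖ * u δ) ≤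
        (∑ γ ∈ L n, ‖h γ‖ * u γ) / 2 := by
      rw [Finset.sum_comm, Finset.sum_div]
      refine Finset.sum_le_sum fun γ _ => ?_
      rw [← Finset.mul_sum, mul_div_assoc]
      refine mul_le_mul_of_nonneg_left (le_trans ?_ (hvb γ)) (norm_nonneg _)
      exact (hvs γ).sum_le_tsum _ fun δ _ => mul_nonneg (norm_nonneg _) (hu _)
    have h4 : ∑ δ ∈ L n, ‖F δ‖ * u δ ≤ ∑' δ, ‖F δ‖ * u δ :=
      hF.sum_le_tsum _ fun δ _ => mul_nonneg (norm_nonneg _) (hu _)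
    linarith
  · have h5 : ∑ γ ∈ s, h γ * v γ δ = ∑ γ ∈ L (W δ), h γ * v γ δ := by
      refine (Finset.sum_subset (fun γ hγ => hs γ ((hL _ _).1 hγ)) fun γ _ hγ => ?_).symm
      by_contra hne
      exact hγ ((hL _ _).2 (hv _ _ (right_ne_zero_of_mul hne)))
    rw [h5, hh δ]
    ring

section ConvergentSeries

variable {σ : Type*} [Fintype σ]

/-- The natural number `∏ pᵢ ^ αᵢ` attached to the exponent `α`. -/
def monWeight (p : σ → ℕ) (α : σ →₀ ℕ) : ℕ := ∏ i, p i ^ α i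

theorem monWeight_add (p : σ → ℕ) (α β : σ →₀ ℕ) :
    monWeight p (α + β) = monWeight p α * monWeight p β := by
  simp [monWeight, pow_add, Finset.prod_mul_distrib]

theorem two_pow_degree_le_monWeight {p : σ → ℕ} (hp : ∀ i, (p i).Prime) (α : σ →₀ ℕ) :
    2 ^ α.degree ≤ monWeight p α := by
  rw [Finsupp.degree_eq_sum, ← Finset.prod_pow_eq_pow_sum]
  exact Finset.prod_le_prod' fun i _ => Nat.pow_le_pow_left (hp i).two_le _

theorem monWeight_pos {p : σ → ℕ} (hp : ∀ i, (p i).Prime) (α : σ →₀ ℕ) :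
    0 < monWeight p α :=
  Finset.prod_pos fun i _ => pow_pos (hp i).pos _

theorem factorization_monWeight {p : σ → ℕ} (hp : ∀ i, (p i).Prime)
    (hinj : Function.Injective p) (α : σ →₀ ℕ) (j : σ) :
    (monWeight p α).factorization (p j) = α j := by
  classical
  rw [monWeight, Nat.factorization_prod fun i _ => pow_ne_zero _ (hp i).ne_zero]
  simp [Finset.sum_apply', Nat.Prime.factorization (hp _), Finsupp.single_apply, hinj.eq_iff]

/-- Absolute convergence on the closed polydisc with radii `pᵢ⁻ᵗ`. -/
def AbsConv (p : σ → ℕ) (t : ℕ) (a : MvPowerSeries σ ℂ) : Prop :=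
  Summable fun α => ‖MvPowerSeries.coeff α a‖ * ((monWeight p α : ℝ)⁻¹) ^ t

variable {p : σ → ℕ} {t : ℕ} {a b : MvPowerSeries σ ℂ}

theorem AbsConv.mono (hp : ∀ i, (p i).Prime) (h : AbsConv p t a) {t' : ℕ} (htt' : t ≤ t') :
    AbsConv p t' a := by
  refine Summable.of_nonneg_of_le (fun α => by positivity) (fun α => ?_) h
  refine mul_le_mul_of_nonneg_left (pow_le_pow_of_le_one (by positivity) ?_ htt') (norm_nonneg _)
  exact inv_le_one_of_one_le₀ (by exact_mod_cast monWeight_pos hp α)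

theorem AbsConv.add (ha : AbsConv p t a) (hb : AbsConv p t b) : AbsConv p t (a + b) := by
  refine Summable.of_nonneg_of_le (fun α => by positivity) (fun α => ?_) (Summable.add ha hb)
  rw [← add_mul, map_add]
  exact mul_le_mul_of_nonneg_right (norm_add_le _ _) (by positivity)

theorem AbsConv.neg (ha : AbsConv p t a) : AbsConv p t (-a) := by
  simpa [AbsConv] using ha

theorem AbsConv.sub (ha : AbsConv p t a) (hb : AbsConv p t b) : AbsConv p t (a - b) :=
  sub_eq_add_neg a b ▸ ha.add hb.neg

theorem AbsConv.coe (p : σ → ℕ) (t : ℕ) (a : MvPolynomial σ ℂ) :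
    AbsConv p t (a : MvPowerSeries σ ℂ) := by
  refine summable_of_hasFiniteSupport (a.support.finite_toSet.subset fun α hα => ?_)
  rw [Function.mem_support] at hα
  simpa using left_ne_zero_of_mul hα

theorem AbsConv.C (p : σ → ℕ) (t : ℕ) (c : ℂ) : AbsConv p t (MvPowerSeries.C c) := by
  simpa using AbsConv.coe p t (MvPolynomial.C c)

theorem AbsConv.sum {ι : Type*} (s : Finset ι) {f : ι → MvPowerSeries σ ℂ}
    (h : ∀ i ∈ s, AbsConv p t (f i)) : AbsConv p t (∑ i ∈ s, f i) := by
  classical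
  induction s using Finset.induction_on with
  | empty => simpa using AbsConv.coe p t 0
  | insert i s hi ih =>
    rw [Finset.sum_insert hi]
    exact (h i (by simp)).add (ih fun j hj => h j (by simp [hj]))

theorem AbsConv.mul (ha : AbsConv p t a) (hb : AbsConv p t b) : AbsConv p t (a * b) := by
  classical
  have := summable_sum_mul_antidiagonal_of_summable_mul
      (Summable.mul_of_nonneg ha hb (fun _ => by positivity) fun _ => by positivity)
  refine Summable.of_nonneg_of_le (fun α => by positivity) (fun α => ?_) this
  rw [MvPowerSeries.coeff_mul]
  refine (mul_le_mul_of_nonneg_right (norm_sum_le _ _) (by positivity)).trans ?_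
  rw [Finset.sum_mul]
  refine Finset.sum_le_sum fun x hx => le_of_eq ?_
  rw [← Finset.HasAntidiagonal.mem_antidiagonal.1 hx, monWeight_add, norm_mul]
  push_cast
  rw [mul_inv, mul_pow]
  ring

end ConvergentSeries

open Filter Topology in
theorem eventually_tail_le {J : Type*} {W : J → ℕ} (hWpos : ∀ j, 0 < W j) {a : J → ℂ} {m : J}
    (ha : ∀ δ, a δ ≠ 0 → W m < W δ) {t₀ : ℕ}
    (hs : Summable fun δ => ‖a δ‖ * ((W δ : ℝ)⁻¹) ^ t₀) :
    ∀ᶠ t in atTop, (Summable fun δ => ‖a δ‖ * ((W δ : ℝ)⁻¹) ^ t) ∧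
      ∑' δ, ‖a δ‖ * ((W δ : ℝ)⁻¹) ^ t ≤ ((W m : ℝ)⁻¹) ^ t / 2 := by
  have hm : (0 : ℝ) < W m := by exact_mod_cast hWpos m
  set S := ∑' δ, ‖a δ‖ * ((W δ : ℝ)⁻¹) ^ t₀ with hS
  have hlim : Tendsto (fun s : ℕ => ((W m : ℝ) * (W m + 1 : ℝ)⁻¹) ^ s * (S * (W m : ℝ) ^ t₀))
      atTop (𝓝 (0 * (S * (W m : ℝ) ^ t₀))) := by
    refine (tendsto_pow_atTop_nhds_zero_of_lt_one (by positivity) ?_).mul_const _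
    rw [← div_eq_mul_inv, div_lt_one (by positivity)]
    linarith
  rw [zero_mul] at hlim
  obtain ⟨s₀, hs₀⟩ := eventually_atTop.1 (hlim.eventually_le_const
    (by norm_num : (0 : ℝ) < 1 / 2))
  refine eventually_atTop.2 ⟨t₀ + s₀, fun t ht => ?_⟩
  obtain ⟨s, rfl⟩ : ∃ s, t = t₀ + s := ⟨t - t₀, by omega⟩
  have hb : ∀ δ, ‖a δ‖ * ((W δ : ℝ)⁻¹) ^ (t₀ + s) ≤
      ‖a δ‖ * ((W δ : ℝ)⁻¹) ^ t₀ * ((W m + 1 : ℝ)⁻¹) ^ s := fun δ => by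
    by_cases h0 : a δ = 0
    · simp [h0]
    · rw [pow_add, ← mul_assoc]
      have : (W m + 1 : ℝ) ≤ W δ := by exact_mod_cast ha δ h0
      gcongr
  have hsum := hs.mul_right (((W m + 1 : ℝ)⁻¹) ^ s)
  have hsum' : Summable fun δ => ‖a δ‖ * ((W δ : ℝ)⁻¹) ^ (t₀ + s) :=
    Summable.of_nonneg_of_le (fun δ => by positivity) hb hsum
  refine ⟨hsum', (hsum'.tsum_le_tsum hb hsum).trans ?_⟩
  rw [tsum_mul_right, ← hS, pow_add]
  have h2 := hs₀ s (by omega)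
  have h3 : S * ((W m + 1 : ℝ)⁻¹) ^ s = ((W m : ℝ) * (W m + 1 : ℝ)⁻¹) ^ s * (S * (W m : ℝ) ^ t₀)
      * (((W m : ℝ)⁻¹) ^ t₀ * ((W m : ℝ)⁻¹) ^ s) := by
    have e1 : (W m : ℝ) ^ s * ((W m : ℝ)⁻¹) ^ s = 1 := by
      rw [← mul_pow, mul_inv_cancel₀ hm.ne', one_pow]
    have e2 : (W m : ℝ) ^ t₀ * ((W m : ℝ)⁻¹) ^ t₀ = 1 := by
      rw [← mul_pow, mul_inv_cancel₀ hm.ne', one_pow]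
    rw [mul_pow]
    linear_combination (-(S * ((W m + 1 : ℝ)⁻¹) ^ s) * (W m : ℝ) ^ t₀ * ((W m : ℝ)⁻¹) ^ t₀) * e1 -
      (S * ((W m + 1 : ℝ)⁻¹) ^ s) * e2
  rw [h3]
  calc _ ≤ 1 / 2 * (((W m : ℝ)⁻¹) ^ t₀ * ((W m : ℝ)⁻¹) ^ s) := by gcongr
    _ = _ := by ring

section StandardBasis

variable {σ κ : Type*} [Fintype σ]

/-- The weight of the monomial vector `z ^ γ.1 • e_{γ.2}`. -/
def vecWeight (p : σ → ℕ) (q : κ → ℕ) (γ : (σ →₀ ℕ) × κ) : ℕ := monWeight p γ.1 * q γ.2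

/-- The coefficient of `z ^ γ.1 • e_{γ.2}` in a vector of power series. -/
noncomputable def vecCoeff (F : κ → MvPowerSeries σ ℂ) (γ : (σ →₀ ℕ) × κ) : ℂ :=
  MvPowerSeries.coeff γ.1 (F γ.2)

variable {p : σ → ℕ} {q : κ → ℕ}

theorem vecWeight_pos (hp : ∀ i, (p i).Prime) (hq : ∀ k, (q k).Prime) (γ : (σ →₀ ℕ) × κ) :
    0 < vecWeight p q γ :=
  Nat.mul_pos (monWeight_pos hp _) (hq _).pos

theorem vecWeight_injective (hp : ∀ i, (p i).Prime) (hq : ∀ k, (q k).Prime)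
    (hpi : Function.Injective p) (hqi : Function.Injective q) (hpq : ∀ i k, p i ≠ q k) :
    Function.Injective (vecWeight p q) := by
  have key : ∀ γ : (σ →₀ ℕ) × κ, ∀ i, (vecWeight p q γ).factorization (p i) = γ.1 i := by
    intro γ i
    rw [vecWeight, Nat.factorization_mul (monWeight_pos hp _).ne' (hq _).ne_zero,
      Finsupp.add_apply, factorization_monWeight hp hpi, (hq _).factorization]
    simp [(hpq i γ.2).symm]
  rintro ⟨α, k⟩ ⟨β, l⟩ h
  have hαβ : α = β := by
    ext i
    rw [← key (α, k) i, ← key (β, l) i, h]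
  subst hαβ
  have : q k = q l := Nat.eq_of_mul_eq_mul_left (monWeight_pos hp α) h
  rw [hqi this]

theorem summable_vecCoeff [Finite κ] (hp : ∀ i, (p i).Prime) (hq : ∀ k, (q k).Prime)
    {F : κ → MvPowerSeries σ ℂ} {t : ℕ} (hF : ∀ k, AbsConv p t (F k)) :
    Summable fun γ => ‖vecCoeff F γ‖ * ((vecWeight p q γ : ℝ)⁻¹) ^ t := by
  have := Fintype.ofFinite κ
  have hs : Summable fun γ : (σ →₀ ℕ) × κ =>
      ‖vecCoeff F γ‖ * ((monWeight p γ.1 : ℝ)⁻¹) ^ t := by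
    refine (summable_prod_of_nonneg fun γ => by positivity).2
      ⟨fun α => (hasSum_fintype _).summable, ?_⟩
    simp_rw [tsum_fintype]
    exact summable_sum fun k _ => hF k
  refine Summable.of_nonneg_of_le (fun γ => by positivity) (fun γ => ?_) hs
  have h1 : (0 : ℝ) < monWeight p γ.1 := by exact_mod_cast monWeight_pos hp γ.1
  have h2 : (1 : ℝ) ≤ q γ.2 := by exact_mod_cast (hq γ.2).one_lt.le
  rw [vecWeight]
  push_cast
  gcongr
  nlinarith

open Filter in
theorem eventually_absConv [Finite κ] (hp : ∀ i, (p i).Prime) {F : κ → MvPowerSeries σ ℂ}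
    (hF : ∀ k, ∃ t, AbsConv p t (F k)) : ∀ᶠ t in atTop, ∀ k, AbsConv p t (F k) := by
  refine eventually_all.2 fun k => ?_
  obtain ⟨t, ht⟩ := hF k
  exact eventually_atTop.2 ⟨t, fun s hs => ht.mono hp hs⟩

open Filter in
/-- Convergent division by finitely many vectors `f m` with leading monomial `m`. -/
theorem exists_division [Finite κ] (hp : ∀ i, (p i).Prime) (hq : ∀ k, (q k).Prime)
    (hpi : Function.Injective p) (hqi : Function.Injective q) (hpq : ∀ i k, p i ≠ q k)
    (Λ : Set ((σ →₀ ℕ) × κ)) (M : Finset ((σ →₀ ℕ) × κ)) (c : (σ →₀ ℕ) × κ → (σ →₀ ℕ) × κ)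
    (hcM : ∀ γ ∈ Λ, c γ ∈ M) (hc1 : ∀ γ ∈ Λ, (c γ).1 ≤ γ.1) (hc2 : ∀ γ ∈ Λ, (c γ).2 = γ.2)
    (f : (σ →₀ ℕ) × κ → κ → MvPowerSeries σ ℂ) (hf1 : ∀ m ∈ M, vecCoeff (f m) m = 1)
    (hlead : ∀ m ∈ M, ∀ δ, vecCoeff (f m) δ ≠ 0 → vecWeight p q m ≤ vecWeight p q δ)
    (hfc : ∀ m ∈ M, ∀ k, ∃ t, AbsConv p t (f m k))
    (F : κ → MvPowerSeries σ ℂ) (hF : ∀ k, ∃ t, AbsConv p t (F k)) :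
    ∃ Q : (σ →₀ ℕ) × κ → MvPowerSeries σ ℂ, (∀ m, ∃ t, AbsConv p t (Q m)) ∧
      ∀ γ ∈ Λ, vecCoeff (F - ∑ m ∈ M, Q m • f m) γ = 0 := by
  classical
  set W := vecWeight p q with hWdef
  have hWpos : ∀ γ, 0 < W γ := vecWeight_pos hp hq
  have hWinj : Function.Injective W := vecWeight_injective hp hq hpi hqi hpq
  let tail : (σ →₀ ℕ) × κ → (σ →₀ ℕ) × κ → ℂ :=
    fun m δ => vecCoeff (f m) δ - if δ = m then 1 else 0
  have htail : ∀ m ∈ M, ∀ δ, tail m δ ≠ 0 → W m < W δ := by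
    intro m hm δ hδ
    by_cases h : δ = m
    · subst h
      simp [tail, hf1 δ hm] at hδ
    · refine lt_of_le_of_ne (hlead m hm δ (by simpa [tail, h] using hδ)) fun h' => h (hWinj h').symm
  obtain ⟨t, hFt, htM⟩ : ∃ t, (∀ k, AbsConv p t (F k)) ∧ ∀ m ∈ M,
      (Summable fun δ => ‖tail m δ‖ * ((W δ : ℝ)⁻¹) ^ t) ∧
        ∑' δ, ‖tail m δ‖ * ((W δ : ℝ)⁻¹) ^ t ≤ ((W m : ℝ)⁻¹) ^ t / 2 := by
    refine ((eventually_absConv hp hF).and ((Filter.eventually_all_finset M).2 fun m hm => ?_)).exists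
    obtain ⟨t₀, ht₀⟩ := (eventually_absConv hp (hfc m hm)).exists
    refine eventually_tail_le hWpos (htail m hm) (t₀ := t₀) ?_
    refine Summable.of_nonneg_of_le (fun δ => by positivity) (fun δ => ?_)
      (summable_vecCoeff hp hq ht₀)
    refine mul_le_mul_of_nonneg_right ?_ (by positivity)
    by_cases h : δ = m
    · subst h
      simp [tail, hf1 δ hm]
    · simp [tail, h]
  let v : (σ →₀ ℕ) × κ → (σ →₀ ℕ) × κ → ℂ := fun γ δ =>
    if γ ∈ Λ ∧ γ.1 - (c γ).1 ≤ δ.1 then tail (c γ) (δ.1 - (γ.1 - (c γ).1), δ.2) else 0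
  let shift : (σ →₀ ℕ) → (σ →₀ ℕ) × κ → (σ →₀ ℕ) × κ := fun β δ => (δ.1 + β, δ.2)
  have hshift : ∀ β, Function.Injective (shift β) := by
    rintro β ⟨x, k⟩ ⟨y, l⟩ h
    simpa [shift] using h
  have hWshift : ∀ β δ, W (shift β δ) = W δ * monWeight p β := by
    intro β δ
    simp only [shift, hWdef, vecWeight, monWeight_add]
    ring
  have hcγ : ∀ γ ∈ Λ, shift (γ.1 - (c γ).1) (c γ) = γ := by
    intro γ hγ
    simp only [shift]
    rw [add_tsub_cancel_of_le (hc1 γ hγ), hc2 γ hγ]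
  have hvshift : ∀ γ ∈ Λ, ∀ δ, v γ (shift (γ.1 - (c γ).1) δ) = tail (c γ) δ := by
    intro γ hγ δ
    simp only [v, shift]
    rw [if_pos ⟨hγ, le_add_self⟩, add_tsub_cancel_right]
  have hvrange : ∀ γ ∈ Λ, ∀ δ, δ ∉ Set.range (shift (γ.1 - (c γ).1)) → v γ δ = 0 := by
    intro γ hγ δ hδ
    refine if_neg fun h => hδ ⟨(δ.1 - (γ.1 - (c γ).1), δ.2), ?_⟩
    simp [shift, tsub_add_cancel_of_le h.2]
  have hvN : ∀ γ, γ ∉ Λ → ∀ δ, v γ δ = 0 := fun γ hγ δ => if_neg fun h => hγ h.1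
  have hvW : ∀ γ δ, v γ δ ≠ 0 → W γ < W δ := by
    intro γ δ h
    by_cases hγ : γ ∈ Λ
    · by_cases hδ : δ ∈ Set.range (shift (γ.1 - (c γ).1))
      · obtain ⟨δ, rfl⟩ := hδ
        rw [hvshift γ hγ] at h
        have := htail _ (hcM γ hγ) _ h
        rw [← hcγ γ hγ, hWshift, hcγ γ hγ, hWshift]
        exact Nat.mul_lt_mul_of_pos_right this (monWeight_pos hp _)
      · exact absurd (hvrange γ hγ δ hδ) h
    · exact absurd (hvN γ hγ δ) h
  have hvsum : ∀ γ, ∃ s ≤ ((W γ : ℝ)⁻¹) ^ t / 2,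
      HasSum (fun δ => ‖v γ δ‖ * ((W δ : ℝ)⁻¹) ^ t) s := by
    intro γ
    by_cases hγ : γ ∈ Λ
    · obtain ⟨h1, h2⟩ := htM _ (hcM γ hγ)
      refine ⟨(∑' δ, ‖tail (c γ) δ‖ * ((W δ : ℝ)⁻¹) ^ t) *
        ((monWeight p (γ.1 - (c γ).1) : ℝ)⁻¹) ^ t, ?_, ?_⟩
      · refine (mul_le_mul_of_nonneg_right h2 (by positivity)).trans (le_of_eq ?_)
        conv_rhs => rw [← hcγ γ hγ, hWshift]
        push_cast
        rw [mul_inv, mul_pow]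
        ring
      · refine ((hshift (γ.1 - (c γ).1)).hasSum_iff fun δ hδ => ?_).1 ?_
        · simp [hvrange γ hγ δ hδ]
        · have heq : (fun δ => ‖v γ δ‖ * ((W δ : ℝ)⁻¹) ^ t) ∘ shift (γ.1 - (c γ).1) =
              fun δ => ‖tail (c γ) δ‖ * ((W δ : ℝ)⁻¹) ^ t *
                ((monWeight p (γ.1 - (c γ).1) : ℝ)⁻¹) ^ t := by
            funext δ
            simp only [Function.comp]
            rw [hvshift γ hγ, hWshift]
            push_cast
            rw [mul_inv, mul_pow]
            ring
          rw [heq]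
          exact h1.hasSum.mul_right _
    · exact ⟨0, by positivity, by simp [hvN γ hγ]⟩
  obtain ⟨h, hhs, hh⟩ := exists_triangular_solution W hWinj (fun δ => ((W δ : ℝ)⁻¹) ^ t)
    (fun δ => by positivity) v hvW (fun γ => (hvsum γ).choose_spec.2.summable)
    (fun γ => by
      have := (hvsum γ).choose_spec
      rw [this.2.tsum_eq]
      exact this.1) (vecCoeff F) (summable_vecCoeff hp hq hFt)
  let Q : (σ →₀ ℕ) × κ → MvPowerSeries σ ℂ := fun m β =>
    if shift β m ∈ Λ ∧ c (shift β m) = m then h (shift β m) else 0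
  have hQ : ∀ m β, MvPowerSeries.coeff β (Q m) =
    if shift β m ∈ Λ ∧ c (shift β m) = m then h (shift β m) else 0 := fun m β => rfl
  refine ⟨Q, fun m => ⟨t, ?_⟩, fun δ hδΛ => ?_⟩
  · have hinj : Function.Injective fun β => shift β m := by
      intro β β' h
      simpa [shift] using h
    have h1 := (hhs.comp_injective hinj).mul_right ((W m : ℝ) ^ t)
    refine Summable.of_nonneg_of_le (fun γ => by positivity) (fun β => ?_) h1
    have hm : (0 : ℝ) < W m := by exact_mod_cast hWpos m
    have h2 : ‖MvPowerSeries.coeff β (Q m)‖ ≤ ‖h (shift β m)‖ := by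
      rw [hQ]
      split_ifs <;> simp
    simp only [Function.comp, hWshift]
    push_cast
    rw [mul_inv, mul_pow, inv_pow (W m : ℝ)]
    have h3 : ‖h (shift β m)‖ * (((W m : ℝ) ^ t)⁻¹ * ((monWeight p β : ℝ)⁻¹) ^ t) * (W m : ℝ) ^ t
      = ‖h (shift β m)‖ * ((monWeight p β : ℝ)⁻¹) ^ t := by field_simp
    rw [h3]
    gcongr
  · have hfin : {γ | W γ ≤ W δ}.Finite := (Set.finite_Iic (W δ)).preimage hWinj.injOn
    set s := hfin.toFinset with hs
    have hmem : ∀ γ, γ ∈ s ↔ W γ ≤ W δ := fun γ => by simp [hs]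
    have hQf : ∀ m ∈ M, vecCoeff (Q m • f m) δ =
        ∑ γ ∈ s with γ ∈ Λ ∧ c γ = m, h γ * ((if γ = δ then 1 else 0) + v γ δ) := by
      intro m hm
      have hg : ∀ γ ∈ Λ, c γ = m → (if γ = δ then 1 else 0) + v γ δ =
          if γ.1 - m.1 ≤ δ.1 then vecCoeff (f m) (δ.1 - (γ.1 - m.1), δ.2) else 0 := by
        rintro γ hγ rfl
        by_cases hle : γ.1 - (c γ).1 ≤ δ.1
        · have hiff : (δ.1 - (γ.1 - (c γ).1), δ.2) = c γ ↔ γ = δ := by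
            constructor
            · intro h
              have h2 : shift (γ.1 - (c γ).1) (δ.1 - (γ.1 - (c γ).1), δ.2) = δ := by
                simp only [shift]
                rw [tsub_add_cancel_of_le hle]
              rw [h] at h2
              exact (hcγ γ hγ).symm.trans h2
            · rintro rfl
              rw [tsub_tsub_cancel_of_le (hc1 γ hγ), ← hc2 γ hγ]
          have hvγ : v γ δ = tail (c γ) (δ.1 - (γ.1 - (c γ).1), δ.2) := if_pos ⟨hγ, hle⟩
          rw [hvγ, if_pos hle]
          simp only [tail]
          by_cases h : γ = δ
          · rw [if_pos h, if_pos (hiff.2 h), add_sub_cancel]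
          · rw [if_neg h, if_neg (hiff.not.2 h), zero_add, sub_zero]
        · have hne : γ ≠ δ := by
            rintro rfl
            exact hle tsub_le_self
          have hvγ : v γ δ = 0 := if_neg fun h => hle h.2
          rw [hvγ, if_neg hne, if_neg hle, add_zero]
      have hLHS : vecCoeff (Q m • f m) δ = ∑ x ∈ Finset.HasAntidiagonal.antidiagonal δ.1,
          MvPowerSeries.coeff x.1 (Q m) * vecCoeff (f m) (x.2, δ.2) := by
        simp only [vecCoeff, Pi.smul_apply, smul_eq_mul]
        rw [MvPowerSeries.coeff_mul]
      have hle : ∀ γ ∈ Λ, c γ = m → h γ * ((if γ = δ then 1 else 0) + v γ δ) ≠ 0 →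
          γ.1 - m.1 ≤ δ.1 := by
        intro γ hγ hc hne
        rw [hg γ hγ hc] at hne
        by_contra hle
        rw [if_neg hle, mul_zero] at hne
        exact hne rfl
      rw [hLHS]
      refine (Finset.sum_bij_ne_zero (fun γ _ _ => (γ.1 - m.1, δ.1 - (γ.1 - m.1)))
        ?_ ?_ ?_ ?_).symm
      · intro γ hγ hne
        obtain ⟨-, hγ, hc⟩ := Finset.mem_filter.1 hγ
        rw [Finset.HasAntidiagonal.mem_antidiagonal]
        exact add_tsub_cancel_of_le (hle γ hγ hc hne)
      · intro γ hγ _ γ' hγ' _ heq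
        obtain ⟨-, hγ, hc⟩ := Finset.mem_filter.1 hγ
        obtain ⟨-, hγ', hc'⟩ := Finset.mem_filter.1 hγ'
        have heq1 : γ.1 - m.1 = γ'.1 - m.1 := (Prod.ext_iff.1 heq).1
        rw [← hcγ γ hγ, ← hcγ γ' hγ', hc, hc', heq1]
      · rintro ⟨β, β'⟩ hβ hne
        rw [Finset.HasAntidiagonal.mem_antidiagonal] at hβ
        have hQne := left_ne_zero_of_mul hne
        have hfne := right_ne_zero_of_mul hne
        rw [hQ] at hQne
        obtain ⟨hγ, hc⟩ := (ite_ne_right_iff.1 hQne).1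
        have hδ : shift β (β', δ.2) = δ := by
          simp only [shift]
          rw [add_comm, hβ]
        have hβm : (shift β m).1 - m.1 = β := by simp [shift]
        have hβ' : δ.1 - β = β' := by rw [← hβ, add_tsub_cancel_left]
        have hβle : β ≤ δ.1 := hβ ▸ le_self_add
        refine ⟨shift β m, Finset.mem_filter.2 ⟨(hmem _).2 ?_, hγ, hc⟩, ?_, ?_⟩
        · rw [← hδ, hWshift, hWshift]
          exact Nat.mul_le_mul_right _ (hlead m hm _ hfne)
        · rw [hg _ hγ hc, hβm, if_pos hβle, hβ']
          refine mul_ne_zero ?_ hfne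
          rwa [if_pos ⟨hγ, hc⟩] at hQne
        · rw [hβm, hβ']
      · intro γ hγ hne
        obtain ⟨-, hγ, hc⟩ := Finset.mem_filter.1 hγ
        have h1 : shift (γ.1 - m.1) m = γ := by rw [← hc, hcγ γ hγ]
        rw [hg γ hγ hc, if_pos (hle γ hγ hc hne), hQ, h1, if_pos ⟨hγ, hc⟩]
    have hsum : vecCoeff (∑ m ∈ M, Q m • f m) δ = ∑ m ∈ M, vecCoeff (Q m • f m) δ := by
      simp [vecCoeff, Finset.sum_apply]
    have h1 : vecCoeff F δ = ∑ γ ∈ s with γ ∈ Λ, h γ * ((if γ = δ then 1 else 0) + v γ δ) := by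
      rw [hh δ s fun γ hγ => (hmem γ).2 hγ.le]
      simp_rw [mul_add]
      rw [Finset.sum_add_distrib]
      congr 1
      · rw [Finset.sum_eq_single δ]
        · simp
        · intro γ _ h
          simp [h]
        · intro h
          simp [hmem, hδΛ] at h
      · rw [Finset.sum_filter]
        refine Finset.sum_congr rfl fun γ _ => ?_
        split_ifs with hγ
        · rfl
        · simp [hvN γ hγ]
    have h2 : vecCoeff (F - ∑ m ∈ M, Q m • f m) δ =
        vecCoeff F δ - vecCoeff (∑ m ∈ M, Q m • f m) δ := by simp [vecCoeff]
    rw [h2, hsum, Finset.sum_congr rfl hQf, h1, sub_eq_zero]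
    rw [← Finset.sum_fiberwise_of_maps_to (t := M) (g := c)]
    · simp_rw [Finset.filter_filter]
    · intro γ hγ
      exact hcM γ (Finset.mem_filter.1 hγ).2

/-- Krull's intersection theorem for modules over convergent power series, by standard bases:
a vector lying in `N` up to terms of arbitrarily high order lies in `N`. -/
theorem mem_of_forall_exists_coeff_eq [Finite κ] (hp : ∀ i, (p i).Prime)
    (hq : ∀ k, (q k).Prime)
    (hpi : Function.Injective p) (hqi : Function.Injective q) (hpq : ∀ i k, p i ≠ q k)
    (N : AddSubgroup (κ → MvPowerSeries σ ℂ)) (hN : ∀ F ∈ N, ∀ k, ∃ t, AbsConv p t (F k))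
    (hsmul : ∀ a t, AbsConv p t a → ∀ F ∈ N, a • F ∈ N)
    (F : κ → MvPowerSeries σ ℂ) (hF : ∀ k, ∃ t, AbsConv p t (F k))
    (happ : ∀ K : ℕ, ∃ G ∈ N, ∀ γ : (σ →₀ ℕ) × κ, γ.1.degree < K → vecCoeff F γ = vecCoeff G γ) :
    F ∈ N := by
  classical
  have := Fintype.ofFinite κ
  set W := vecWeight p q with hWdef
  have hWinj : Function.Injective W := vecWeight_injective hp hq hpi hqi hpq
  let Λ : Set ((σ →₀ ℕ) × κ) := {γ | ∃ f ∈ N, vecCoeff f γ = 1 ∧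
    ∀ δ, vecCoeff f δ ≠ 0 → W γ ≤ W δ}
  let Mk : κ → Set (σ →₀ ℕ) := fun k => {α | Minimal (fun α => (α, k) ∈ Λ) α}
  have hMk : ∀ k, (Mk k).Finite := fun k =>
    (setOfPred_minimal_antichain _).finite_of_partiallyWellOrderedOn
      (Set.isPWO_of_wellQuasiOrderedLE _)
  let M : Finset ((σ →₀ ℕ) × κ) :=
    Finset.univ.biUnion fun k => (hMk k).toFinset.image fun α => (α, k)
  have hM : ∀ γ, γ ∈ M ↔ Minimal (fun α => (α, γ.2) ∈ Λ) γ.1 := by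
    rintro ⟨α, k⟩
    simp [M, Mk]
  have hc : ∀ γ, ∃ m, γ ∈ Λ → m ∈ M ∧ m.1 ≤ γ.1 ∧ m.2 = γ.2 := by
    intro γ
    by_cases hγ : γ ∈ Λ
    · obtain ⟨α, hα, hmin⟩ := exists_minimal_le_of_wellFoundedLT (fun α => (α, γ.2) ∈ Λ) γ.1 hγ
      exact ⟨(α, γ.2), fun _ => ⟨(hM _).2 hmin, hα, rfl⟩⟩
    · exact ⟨γ, fun h => absurd h hγ⟩
  choose c hc using hc
  have hf : ∀ m, ∃ f ∈ N, m ∈ M → vecCoeff f m = 1 ∧ ∀ δ, vecCoeff f δ ≠ 0 → W m ≤ W δ := by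
    intro m
    by_cases hm : m ∈ M
    · obtain ⟨f, hfN, h1, h2⟩ := ((hM m).1 hm).prop
      exact ⟨f, hfN, fun _ => ⟨h1, h2⟩⟩
    · exact ⟨0, N.zero_mem, fun h => absurd h hm⟩
  choose f hfN hf using hf
  obtain ⟨Q, hQ, hr⟩ := exists_division hp hq hpi hqi hpq Λ M c (fun γ hγ => (hc γ hγ).1)
    (fun γ hγ => (hc γ hγ).2.1) (fun γ hγ => (hc γ hγ).2.2) f (fun m hm => (hf m hm).1)
    (fun m hm => (hf m hm).2) (fun m _ => hN _ (hfN m)) F hF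
  set S := ∑ m ∈ M, Q m • f m with hS
  have hSN : S ∈ N := N.sum_mem fun m _ => by
    obtain ⟨t, ht⟩ := hQ m
    exact hsmul _ t ht _ (hfN m)
  suffices hzero : ∀ γ, vecCoeff (F - S) γ = 0 by
    have hFS : F - S = 0 := by
      funext k
      ext α
      exact hzero (α, k)
    rwa [sub_eq_zero.1 hFS]
  by_contra! hne
  let wf : WellFounded fun a b : (σ →₀ ℕ) × κ => W a < W b := InvImage.wf W Nat.lt_wfRel.wf
  obtain ⟨γ, hγ, hmin⟩ := wf.has_min {γ | vecCoeff (F - S) γ ≠ 0} hne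
  obtain ⟨G, hG, hGF⟩ := happ (W γ)
  have hsub : ∀ (A B : κ → MvPowerSeries σ ℂ) δ, vecCoeff (A - B) δ = vecCoeff A δ - vecCoeff B δ :=
    fun A B δ => by simp [vecCoeff]
  have hdeg : ∀ δ : (σ →₀ ℕ) × κ, W δ ≤ W γ → δ.1.degree < W γ := by
    intro δ hδ
    refine lt_of_lt_of_le (Nat.lt_two_pow_self) (le_trans ?_ hδ)
    exact (two_pow_degree_le_monWeight hp δ.1).trans
      (Nat.le_mul_of_pos_right _ (hq δ.2).pos)
  have hlow : ∀ δ, W δ ≤ W γ → vecCoeff (G - S) δ = vecCoeff (F - S) δ := by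
    intro δ hδ
    rw [hsub, hsub, hGF δ (hdeg δ hδ)]
  set x := vecCoeff (F - S) γ with hx
  refine hγ (hr γ ⟨(MvPowerSeries.C x⁻¹ : MvPowerSeries σ ℂ) • (G - S),
    hsmul _ 0 (AbsConv.C p 0 _) _ (N.sub_mem hG hSN), ?_, ?_⟩)
  · have h1 : vecCoeff ((MvPowerSeries.C x⁻¹ : MvPowerSeries σ ℂ) • (G - S)) γ = x⁻¹ * vecCoeff (G - S) γ := by
      simp [vecCoeff]
    rw [h1, hlow γ le_rfl, inv_mul_cancel₀ hγ]
  · intro δ hδ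
    have h1 : vecCoeff ((MvPowerSeries.C x⁻¹ : MvPowerSeries σ ℂ) • (G - S)) δ = x⁻¹ * vecCoeff (G - S) δ := by
      simp [vecCoeff]
    rw [h1] at hδ
    by_contra! hlt
    have h2 := right_ne_zero_of_mul hδ
    rw [hlow δ hlt.le] at h2
    exact hmin δ h2 hlt

end StandardBasis

section Holomorphic

variable {σ : Type*} [Fintype σ]

open Metric in
theorem norm_fderiv_le_of_norm_le {E : Type*} [NormedAddCommGroup E] [NormedSpace ℂ E]
    {f : E → ℂ} {U : Set E} (hU : IsOpen U) (hf : DifferentiableOn ℂ f U) {z : E} {r C : ℝ}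
    (hr : 0 < r) (hzU : closedBall z r ⊆ U) (hC : ∀ w ∈ closedBall z r, ‖f w‖ ≤ C) :
    ‖fderiv ℂ f z‖ ≤ C / r := by
  have hC0 : 0 ≤ C := (norm_nonneg _).trans (hC z (mem_closedBall_self hr.le))
  refine ContinuousLinearMap.opNorm_le_bound _ (by positivity) fun v => ?_
  by_cases hv : v = 0
  · simp [hv]
  have hv' : 0 < ‖v‖ := norm_pos_iff.2 hv
  have hline : ∀ s : ℂ, ‖s‖ ≤ r / ‖v‖ → z + s • v ∈ closedBall z r := by
    intro s hs
    rw [mem_closedBall, dist_self_add_left, norm_smul]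
    exact (le_div_iff₀ hv').1 hs
  have hdiff : ∀ s : ℂ, ‖s‖ ≤ r / ‖v‖ →
      HasDerivAt (fun s : ℂ => f (z + s • v)) (fderiv ℂ f (z + s • v) v) s := by
    intro s hs
    have h1 : HasFDerivAt f (fderiv ℂ f (z + s • v)) (z + s • v) :=
      ((hf _ (hzU (hline s hs))).differentiableAt
        (hU.mem_nhds (hzU (hline s hs)))).hasFDerivAt
    have h2 : HasDerivAt (fun s : ℂ => z + s • v) v s := by
      simpa using ((hasDerivAt_id s).smul_const v).const_add z
    exact h1.comp_hasDerivAt s h2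
  have hd : DiffContOnCl ℂ (fun s : ℂ => f (z + s • v)) (ball 0 (r / ‖v‖)) := by
    refine DifferentiableOn.diffContOnCl fun s hs => ?_
    rw [closure_ball _ (by positivity), mem_closedBall_zero_iff] at hs
    exact (hdiff s hs).differentiableAt.differentiableWithinAt
  have h := Complex.norm_deriv_le_of_forall_mem_sphere_norm_le (by positivity) hd
    (C := C) fun s hs => hC _ (hline s (mem_sphere_zero_iff_norm.1 hs).le)
  rw [(hdiff 0 (by simp; positivity)).deriv] at h
  simp only [zero_smul, add_zero] at h
  refine h.trans (le_of_eq ?_)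
  field_simp

open Metric Complex in
/-- Directional derivatives of holomorphic functions of several variables are holomorphic. -/
theorem differentiableOn_fderiv_apply {f : (σ → ℂ) → ℂ} {U : Set (σ → ℂ)} (hU : IsOpen U)
    (hf : DifferentiableOn ℂ f U) (v : σ → ℂ) :
    DifferentiableOn ℂ (fun z => fderiv ℂ f z v) U := by
  intro z₀ hz₀
  refine DifferentiableAt.differentiableWithinAt ?_
  obtain ⟨R, hR, hRU⟩ := nhds_basis_closedBall.mem_iff.1 (hU.mem_nhds hz₀)
  obtain ⟨C, hC⟩ := (isCompact_closedBall z₀ R).exists_bound_of_continuousOn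
    (hf.continuousOn.mono hRU)
  set ε := R / 3 with hε
  have hε0 : 0 < ε := by positivity
  set δ := ε / (‖v‖ + 1) with hδ
  have hδ0 : 0 < δ := by positivity
  have hδv : δ * ‖v‖ ≤ ε := by
    rw [hδ, div_mul_eq_mul_div, div_le_iff₀ (by positivity)]
    nlinarith [norm_nonneg v]
  have hmem : ∀ z ∈ ball z₀ ε, ∀ s : ℂ, ‖s‖ ≤ δ → closedBall (z + s • v) ε ⊆ closedBall z₀ R := by
    intro z hz s hs
    refine closedBall_subset_closedBall' ?_
    have h1 : Dist.dist (z + s • v) z₀ ≤ Dist.dist (z + s • v) z + Dist.dist z z₀ := dist_triangle _ _ _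
    rw [dist_self_add_left, norm_smul] at h1
    have h2 := mul_le_mul_of_nonneg_right hs (norm_nonneg v)
    have h3 := mem_ball.1 hz
    linarith
  have hmem' : ∀ z ∈ ball z₀ ε, ∀ s : ℂ, ‖s‖ ≤ δ → z + s • v ∈ U := fun z hz s hs =>
    hRU (hmem z hz s hs (mem_closedBall_self hε0.le))
  have hfd : ∀ z ∈ ball z₀ ε, ∀ s : ℂ, ‖s‖ ≤ δ →
      HasFDerivAt f (fderiv ℂ f (z + s • v)) (z + s • v) := fun z hz s hs =>
    ((hf _ (hmem' z hz s hs)).differentiableAt (hU.mem_nhds (hmem' z hz s hs))).hasFDerivAt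
  have hbound : ∀ z ∈ ball z₀ ε, ∀ s : ℂ, ‖s‖ ≤ δ → ‖fderiv ℂ f (z + s • v)‖ ≤ C / ε :=
    fun z hz s hs => norm_fderiv_le_of_norm_le hU hf hε0 ((hmem z hz s hs).trans hRU)
      fun w hw => hC w (hmem z hz s hs hw)
  have hcirc : ∀ θ, ‖circleMap 0 δ θ‖ ≤ δ := fun θ => by
    rw [norm_circleMap_zero, abs_of_pos hδ0]
  let k : ℝ → ℂ := fun θ => (2 * Real.pi * I : ℂ)⁻¹ * (deriv (circleMap 0 δ) θ *
    ((circleMap 0 δ θ) ^ 2)⁻¹)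
  have hk : Continuous k := by
    refine continuous_const.mul (Continuous.mul ?_ (Continuous.inv₀ (by fun_prop) fun θ => ?_))
    · rw [show deriv (circleMap 0 δ) = fun θ => circleMap 0 δ θ * I from
        funext fun θ => deriv_circleMap 0 δ θ]
      fun_prop
    · exact pow_ne_zero _ (circleMap_ne_center hδ0.ne')
  have hrepr : ∀ z ∈ ball z₀ ε, fderiv ℂ f z v =
      ∫ θ in (0 : ℝ)..2 * Real.pi, k θ * f (z + circleMap 0 δ θ • v) := by
    intro z hz
    have hd : ∀ s : ℂ, ‖s‖ ≤ δ →
        HasDerivAt (fun s : ℂ => f (z + s • v)) (fderiv ℂ f (z + s • v) v) s := by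
      intro s hs
      have h2 : HasDerivAt (fun s : ℂ => z + s • v) v s := by
        simpa using ((hasDerivAt_id s).smul_const v).const_add z
      exact (hfd z hz s hs).comp_hasDerivAt s h2
    have hopen : IsOpen ((fun s : ℂ => z + s • v) ⁻¹' U) := hU.preimage (by fun_prop)
    have hdo : DifferentiableOn ℂ (fun s : ℂ => f (z + s • v)) ((fun s : ℂ => z + s • v) ⁻¹' U) :=
      hf.comp (by fun_prop) fun s hs => hs
    have h1 := cderiv_eq_deriv (z := 0) hopen hdo hδ0 fun s hs => by
      exact hmem' z hz s (mem_closedBall_zero_iff.1 hs)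
    rw [(hd 0 (by simpa using hδ0.le)).deriv] at h1
    simp only [zero_smul, add_zero] at h1
    rw [← h1, cderiv, circleIntegral, ← intervalIntegral.integral_smul]
    refine intervalIntegral.integral_congr fun θ _ => ?_
    simp only [k, smul_eq_mul, sub_zero]
    ring
  have hcont : ∀ z ∈ ball z₀ ε, Continuous fun θ => k θ * f (z + circleMap 0 δ θ • v) := by
    intro z hz
    refine hk.mul (continuous_iff_continuousAt.2 fun θ => ?_)
    exact ContinuousAt.comp (f := fun θ => z + circleMap 0 δ θ • v)
      (hfd z hz _ (hcirc θ)).continuousAt (by fun_prop)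
  have hz₀ε : z₀ ∈ ball z₀ ε := mem_ball_self hε0
  have hmain := intervalIntegral.hasFDerivAt_integral_of_dominated_of_fderiv_le
    (μ := MeasureTheory.volume) (a := 0) (b := 2 * Real.pi) (𝕜 := ℂ)
    (F := fun z θ => k θ * f (z + circleMap 0 δ θ • v))
    (F' := fun z θ => k θ • fderiv ℂ f (z + circleMap 0 δ θ • v))
    (bound := fun θ => ‖k θ‖ * (C / ε)) (ball_mem_nhds z₀ hε0)
    (Filter.eventually_of_mem (ball_mem_nhds z₀ hε0) fun z hz =>
      (hcont z hz).aestronglyMeasurable)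
    ((hcont z₀ hz₀ε).intervalIntegrable _ _)
    (by
      refine hk.aestronglyMeasurable.smul (Measurable.aestronglyMeasurable ?_)
      exact (measurable_fderiv ℂ f).comp (by fun_prop))
    (Filter.Eventually.of_forall fun θ _ z hz => by
      rw [norm_smul]
      exact mul_le_mul_of_nonneg_left (hbound z hz _ (hcirc θ)) (norm_nonneg _))
    ((hk.norm.mul continuous_const).intervalIntegrable _ _)
    (Filter.Eventually.of_forall fun θ _ z hz => by
      have h1 := (hfd z hz _ (hcirc θ)).comp z ((hasFDerivAt_id z).add_const (circleMap 0 δ θ • v))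
      simpa using h1.const_mul (k θ))
  refine (hmain.differentiableAt).congr_of_eventuallyEq ?_
  exact Filter.eventually_of_mem (ball_mem_nhds z₀ hε0) hrepr

end Holomorphic

section Wirtinger

open Filter Topology Complex
open scoped ContDiff

variable {σ : Type*} [Fintype σ] [DecidableEq σ]

/-- The Wirtinger derivative `∂f/∂z_j`. -/
noncomputable def wirtinger (j : σ) (f : (σ → ℂ) → ℂ) (z : σ → ℂ) : ℂ :=
  (fderiv ℝ f z (Pi.single j 1) - I * fderiv ℝ f z (Pi.single j I)) / 2

variable {f g : (σ → ℂ) → ℂ} {x : σ → ℂ}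

theorem wirtinger_congr (j : σ) (h : f =ᶠ[𝓝 x] g) : wirtinger j f =ᶠ[𝓝 x] wirtinger j g := by
  filter_upwards [h.fderiv (𝕜 := ℝ)] with z hz
  rw [wirtinger, wirtinger, hz]

theorem ContDiffAt.eventually_of_infty (hf : ContDiffAt ℝ ∞ f x) (n : ℕ) :
    ∀ᶠ z in 𝓝 x, ContDiffAt ℝ n f z :=
  (hf.of_le (by exact_mod_cast le_top)).eventually (by simp)

theorem ContDiffAt.eventually_differentiableAt (hf : ContDiffAt ℝ ∞ f x) :
    ∀ᶠ z in 𝓝 x, DifferentiableAt ℝ f z := by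
  filter_upwards [hf.eventually_of_infty 1] with z hz
  exact hz.differentiableAt (by simp)

theorem ContDiffAt.wirtinger (hf : ContDiffAt ℝ ∞ f x) (j : σ) :
    ContDiffAt ℝ ∞ (wirtinger j f) x := by
  have h : ContDiffAt ℝ ∞ (fderiv ℝ f) x := hf.fderiv_right (by simp)
  exact ((h.clm_apply contDiffAt_const).sub
    (contDiffAt_const.mul (h.clm_apply contDiffAt_const))).div_const 2

theorem wirtinger_add (hf : ContDiffAt ℝ ∞ f x) (hg : ContDiffAt ℝ ∞ g x) (j : σ) :
    wirtinger j (f + g) =ᶠ[𝓝 x] wirtinger j f + wirtinger j g := by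
  filter_upwards [hf.eventually_differentiableAt, hg.eventually_differentiableAt] with z hfz hgz
  simp only [wirtinger, Pi.add_apply, fderiv_add hfz hgz, add_apply]
  ring

theorem wirtinger_mul (hf : ContDiffAt ℝ ∞ f x) (hg : ContDiffAt ℝ ∞ g x) (j : σ) :
    wirtinger j (f * g) =ᶠ[𝓝 x] f * wirtinger j g + g * wirtinger j f := by
  filter_upwards [hf.eventually_differentiableAt, hg.eventually_differentiableAt] with z hfz hgz
  simp only [wirtinger, Pi.add_apply, Pi.mul_apply, fderiv_mul hfz hgz, add_apply,
    smul_apply, smul_eq_mul]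
  ring

theorem wirtinger_const (c : ℂ) (j : σ) : wirtinger j (fun _ => c) = 0 := by
  funext z
  simp [wirtinger]

theorem wirtinger_comm (hf : ContDiffAt ℝ ∞ f x) (i j : σ) :
    wirtinger i (wirtinger j f) =ᶠ[𝓝 x] wirtinger j (wirtinger i f) := by
  filter_upwards [hf.eventually_of_infty 2] with z hz
  have hsymm : IsSymmSndFDerivAt ℝ f z := hz.isSymmSndFDerivAt (by simp)
  have hd : DifferentiableAt ℝ (fderiv ℝ f) z :=
    (hz.fderiv_right (m := 1) (by norm_num)).differentiableAt (by simp)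
  have happ : ∀ v, HasFDerivAt (fun y => fderiv ℝ f y v)
      ((fderiv ℝ (fderiv ℝ f) z).flip v) z := fun v => by
    simpa using hd.hasFDerivAt.clm_apply (hasFDerivAt_const v z)
  have key : ∀ k w, fderiv ℝ (wirtinger k f) z w =
      (fderiv ℝ (fderiv ℝ f) z w (Pi.single k 1) -
        I * fderiv ℝ (fderiv ℝ f) z w (Pi.single k I)) / 2 := by
    intro k w
    have h := ((happ (Pi.single k 1)).sub ((happ (Pi.single k I)).const_mul I)).mul_const (2⁻¹ : ℂ)
    have h' : HasFDerivAt (wirtinger k f) _ z := h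
    rw [h'.fderiv]
    simp [div_eq_inv_mul]
  rw [wirtinger, wirtinger, key, key, key, key, hsymm.eq (Pi.single i 1) (Pi.single j 1),
    hsymm.eq (Pi.single i I) (Pi.single j 1), hsymm.eq (Pi.single i 1) (Pi.single j I),
    hsymm.eq (Pi.single i I) (Pi.single j I)]
  ring

theorem wirtinger_eq_fderiv {z : σ → ℂ} (hf : DifferentiableAt ℂ f z) (j : σ) :
    wirtinger j f z = fderiv ℂ f z (Pi.single j 1) := by
  have h : Pi.single j I = I • (Pi.single j 1 : σ → ℂ) := by
    rw [← Pi.single_smul, smul_eq_mul, mul_one]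
  rw [wirtinger, hf.fderiv_restrictScalars ℝ]
  simp only [ContinuousLinearMap.coe_restrictScalars', h, map_smul, smul_eq_mul]
  rw [← mul_assoc, I_mul_I]
  ring

/-- Iterated Wirtinger derivatives. -/
noncomputable def iterWirtinger (l : List σ) (f : (σ → ℂ) → ℂ) : (σ → ℂ) → ℂ :=
  l.foldr wirtinger f

theorem ContDiffAt.iterWirtinger (hf : ContDiffAt ℝ ∞ f x) (l : List σ) :
    ContDiffAt ℝ ∞ (iterWirtinger l f) x := by
  induction l with
  | nil => exact hf
  | cons j l ih => exact ih.wirtinger j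

theorem iterWirtinger_congr (h : f =ᶠ[𝓝 x] g) (l : List σ) :
    iterWirtinger l f =ᶠ[𝓝 x] iterWirtinger l g := by
  induction l with
  | nil => exact h
  | cons j l ih => exact wirtinger_congr j ih

theorem iterWirtinger_perm (hf : ContDiffAt ℝ ∞ f x) {l l' : List σ} (h : l.Perm l') :
    iterWirtinger l f =ᶠ[𝓝 x] iterWirtinger l' f := by
  induction h with
  | nil => rfl
  | cons j _ ih => exact wirtinger_congr j ih
  | swap i j l => exact wirtinger_comm (hf.iterWirtinger l) j i
  | trans _ _ ih ih' => exact ih.trans ih'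

theorem iterWirtinger_append (l l' : List σ) :
    iterWirtinger (l ++ l') f = iterWirtinger l (iterWirtinger l' f) :=
  List.foldr_append

/-- The formal Taylor series at `0` with respect to the Wirtinger derivatives. -/
noncomputable def taylor (f : (σ → ℂ) → ℂ) : MvPowerSeries σ ℂ := fun α =>
  iterWirtinger (Finsupp.toMultiset α).toList f 0 / ∏ i, (α i).factorial

theorem coeff_taylor (f : (σ → ℂ) → ℂ) (α : σ →₀ ℕ) : MvPowerSeries.coeff α (taylor f) =
    iterWirtinger (Finsupp.toMultiset α).toList f 0 / ∏ i, ((α i).factorial : ℂ) := by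
  rw [MvPowerSeries.coeff_apply, taylor]
  push_cast
  rfl

theorem taylor_congr (h : f =ᶠ[𝓝 0] g) : taylor f = taylor g := by
  ext α
  rw [coeff_taylor, coeff_taylor, (iterWirtinger_congr h _).self_of_nhds]

theorem constantCoeff_taylor (f : (σ → ℂ) → ℂ) : MvPowerSeries.coeff 0 (taylor f) = f 0 := by
  simp [coeff_taylor, iterWirtinger]

theorem coeff_taylor_wirtinger (hf : ContDiffAt ℝ ∞ f 0) (j : σ) (α : σ →₀ ℕ) :
    MvPowerSeries.coeff α (taylor (wirtinger j f)) =
      MvPowerSeries.coeff (α + Finsupp.single j 1) (taylor f) * (α j + 1) := by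
  have hperm : ((Finsupp.toMultiset α).toList ++ [j]).Perm
      (Finsupp.toMultiset (α + Finsupp.single j 1)).toList := by
    rw [← Multiset.coe_eq_coe, ← Multiset.coe_add, Multiset.coe_toList, Multiset.coe_toList,
      map_add, Finsupp.toMultiset_single, one_smul, Multiset.coe_singleton]
  have hprod : ∏ i, (((α + Finsupp.single j 1 : σ →₀ ℕ) i).factorial : ℂ) =
      (∏ i, ((α i).factorial : ℂ)) * (α j + 1) := by
    rw [← Finset.mul_prod_erase _ _ (Finset.mem_univ j), ← Finset.mul_prod_erase _
      (fun i => ((α i).factorial : ℂ)) (Finset.mem_univ j)]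
    have h1 : ∏ i ∈ Finset.univ.erase j, (((α + Finsupp.single j 1 : σ →₀ ℕ) i).factorial : ℂ) =
        ∏ i ∈ Finset.univ.erase j, ((α i).factorial : ℂ) := by
      refine Finset.prod_congr rfl fun i hi => ?_
      rw [Finsupp.add_apply, Finsupp.single_eq_of_ne (Finset.ne_of_mem_erase hi), add_zero]
    rw [h1, Finsupp.add_apply, Finsupp.single_eq_same, Nat.factorial_succ]
    push_cast
    ring
  have h0 : (∏ i, ((α i).factorial : ℂ)) ≠ 0 :=
    Finset.prod_ne_zero_iff.2 fun i _ => by exact_mod_cast Nat.factorial_ne_zero _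
  have h1 : (α j + 1 : ℂ) ≠ 0 := by exact_mod_cast Nat.succ_ne_zero (α j)
  rw [coeff_taylor, coeff_taylor, hprod, ← (iterWirtinger_perm hf hperm).self_of_nhds,
    iterWirtinger_append]
  change iterWirtinger _ (wirtinger j f) 0 / _ = iterWirtinger _ (wirtinger j f) 0 / _ * _
  field_simp

theorem taylor_wirtinger (hf : ContDiffAt ℝ ∞ f 0) (j : σ) :
    taylor (wirtinger j f) = MvPowerSeries.pderiv ℂ j (taylor f) := by
  ext α
  rw [coeff_taylor_wirtinger hf, MvPowerSeries.coeff_pderiv]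

/-- Induction on exponents, adding one variable at a time. -/
theorem Finsupp.induction_add_single {P : (σ →₀ ℕ) → Prop} (h0 : P 0)
    (h : ∀ α j, P α → P (α + Finsupp.single j 1)) (α : σ →₀ ℕ) : P α := by
  induction hn : α.degree generalizing α with
  | zero => rwa [(Finsupp.degree_eq_zero_iff α).1 hn]
  | succ n ih =>
    obtain ⟨j, hj⟩ : ∃ j, α j ≠ 0 := by
      by_contra! hα
      rw [show α = 0 from Finsupp.ext hα, map_zero] at hn
      omega
    have hle : Finsupp.single j 1 ≤ α := by
      rw [Finsupp.single_le_iff]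
      omega
    rw [← tsub_add_cancel_of_le hle] at hn ⊢
    rw [map_add, Finsupp.degree_single] at hn
    exact h _ _ (ih _ (by omega))

theorem coeff_add_single_eq {R : Type*} {a b : MvPowerSeries R ℂ} {α : R →₀ ℕ} {j : R}
    (h : MvPowerSeries.coeff α (MvPowerSeries.pderiv ℂ j a) =
      MvPowerSeries.coeff α (MvPowerSeries.pderiv ℂ j b)) :
    MvPowerSeries.coeff (α + Finsupp.single j 1) a =
      MvPowerSeries.coeff (α + Finsupp.single j 1) b := by
  rw [MvPowerSeries.coeff_pderiv, MvPowerSeries.coeff_pderiv] at h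
  exact mul_right_cancel₀ (by exact_mod_cast Nat.succ_ne_zero (α j)) h

theorem taylor_add (hf : ContDiffAt ℝ ∞ f 0) (hg : ContDiffAt ℝ ∞ g 0) :
    taylor (f + g) = taylor f + taylor g := by
  ext α
  induction α using Finsupp.induction_add_single generalizing f g with
  | h0 => rw [map_add]; simp only [constantCoeff_taylor, Pi.add_apply]
  | h α j ih =>
    apply coeff_add_single_eq
    rw [map_add, ← taylor_wirtinger hf, ← taylor_wirtinger hg, ← taylor_wirtinger (show ContDiffAt ℝ ∞ (f + g) 0 from hf.add hg),
      taylor_congr (wirtinger_add hf hg j), ih (hf.wirtinger j) (hg.wirtinger j)]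

theorem taylor_mul (hf : ContDiffAt ℝ ∞ f 0) (hg : ContDiffAt ℝ ∞ g 0) :
    taylor (f * g) = taylor f * taylor g := by
  ext α
  induction α using Finsupp.induction_add_single generalizing f g with
  | h0 =>
    simp only [constantCoeff_taylor, Pi.mul_apply, MvPowerSeries.coeff_zero_eq_constantCoeff,
      map_mul]
    simp only [← MvPowerSeries.coeff_zero_eq_constantCoeff_apply, constantCoeff_taylor]
  | h α j ih =>
    apply coeff_add_single_eq
    rw [Derivation.leibniz, smul_eq_mul, smul_eq_mul, ← taylor_wirtinger hf,
      ← taylor_wirtinger hg, ← taylor_wirtinger (show ContDiffAt ℝ ∞ (f * g) 0 from hf.mul hg),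
      taylor_congr (wirtinger_mul hf hg j), taylor_add (f := f * wirtinger j g) (g := g * wirtinger j f)
      (hf.mul (hg.wirtinger j)) (hg.mul (hf.wirtinger j)), map_add, map_add, ih hf (hg.wirtinger j),
      ih hg (hf.wirtinger j)]

theorem taylor_const (c : ℂ) : taylor (fun _ : σ → ℂ => c) = MvPowerSeries.C c := by
  ext α
  induction α using Finsupp.induction_add_single generalizing c with
  | h0 => rw [constantCoeff_taylor]; simp
  | h α j ih =>
    apply coeff_add_single_eq
    rw [← taylor_wirtinger contDiffAt_const, wirtinger_const, MvPowerSeries.coeff_pderiv,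
      MvPowerSeries.coeff_C, if_neg (by simp), zero_mul]
    have := ih 0
    rw [map_zero] at this
    exact this

theorem taylor_sum {ι : Type*} (s : Finset ι) {F : ι → (σ → ℂ) → ℂ}
    (hF : ∀ i ∈ s, ContDiffAt ℝ ∞ (F i) 0) :
    taylor (fun z => ∑ i ∈ s, F i z) = ∑ i ∈ s, taylor (F i) := by
  classical
  induction s using Finset.induction_on with
  | empty => simpa using taylor_const (σ := σ) 0
  | insert i s hi ih =>
    simp only [Finset.sum_insert hi]
    rw [← ih fun k hk => hF k (Finset.mem_insert_of_mem hk)]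
    exact taylor_add (hF i (Finset.mem_insert_self _ _))
      (ContDiffAt.sum fun k hk => hF k (Finset.mem_insert_of_mem hk))

end Wirtinger

section HolomorphicTaylor

open Filter Topology Metric
open scoped ContDiff

variable {σ : Type*} [Fintype σ] [DecidableEq σ] {f : (σ → ℂ) → ℂ} {U : Set (σ → ℂ)}

theorem DifferentiableOn.contDiffAt_real (hU : IsOpen U) (hf : DifferentiableOn ℂ f U)
    {x : σ → ℂ} (hx : x ∈ U) : ContDiffAt ℝ ∞ f x := by
  have h : ∀ n : ℕ, ∀ g : (σ → ℂ) → ℂ, DifferentiableOn ℂ g U → ContDiffOn ℂ n g U := by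
    intro n
    induction n with
    | zero => exact fun g hg => contDiffOn_zero.2 hg.continuousOn
    | succ n ih =>
      intro g hg
      push_cast
      refine (contDiffOn_succ_iff_fderiv_of_isOpen hU).2 ⟨hg, by simp, ?_⟩
      exact contDiffOn_clm_apply.2 fun v => ih _ (differentiableOn_fderiv_apply hU hg v)
  have h' : ContDiffOn ℂ ∞ f U := contDiffOn_infty.2 fun n => h n f hf
  exact (h'.contDiffAt (hU.mem_nhds hx)).restrict_scalars ℝ

theorem DifferentiableOn.wirtinger_eqOn (hU : IsOpen U) (hf : DifferentiableOn ℂ f U) (j : σ) :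
    Set.EqOn (wirtinger j f) (fun z => fderiv ℂ f z (Pi.single j 1)) U := fun _ hz =>
  wirtinger_eq_fderiv ((hf _ hz).differentiableAt (hU.mem_nhds hz)) j

theorem DifferentiableOn.wirtinger (hU : IsOpen U) (hf : DifferentiableOn ℂ f U) (j : σ) :
    DifferentiableOn ℂ (wirtinger j f) U :=
  (differentiableOn_fderiv_apply hU hf _).congr (hf.wirtinger_eqOn hU j)

theorem DifferentiableOn.iterWirtinger (hU : IsOpen U) (hf : DifferentiableOn ℂ f U)
    (l : List σ) : DifferentiableOn ℂ (iterWirtinger l f) U := by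
  induction l with
  | nil => exact hf
  | cons j l ih => exact ih.wirtinger hU j

theorem iteratedDeriv_line_eq_zero {R : ℝ} (hR : 0 < R) (hf : DifferentiableOn ℂ f (ball 0 R))
    (h0 : taylor f = 0) (z : σ → ℂ) (k : ℕ) : iteratedDeriv k (fun s : ℂ => f (s • z)) 0 = 0 := by
  induction k generalizing f with
  | zero =>
    rw [iteratedDeriv_zero, zero_smul, ← constantCoeff_taylor f, h0, map_zero]
  | succ k ih =>
    let f' : (σ → ℂ) → ℂ := fun y => ∑ j, z j * wirtinger j f y
    have hw : ∀ j, DifferentiableOn ℂ (fun y => z j * wirtinger j f y) (ball 0 R) := fun j =>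
      (hf.wirtinger isOpen_ball j).const_mul _
    have hf' : DifferentiableOn ℂ f' (ball 0 R) := DifferentiableOn.fun_sum fun j _ => hw j
    have hs : ContDiffAt ℝ ∞ f 0 := hf.contDiffAt_real isOpen_ball (mem_ball_self hR)
    have hzero : taylor f' = 0 := by
      rw [taylor_sum _ fun j _ => (hw j).contDiffAt_real isOpen_ball (mem_ball_self hR)]
      refine Finset.sum_eq_zero fun j _ => ?_
      have h1 := taylor_mul (f := fun _ => z j) contDiffAt_const (hs.wirtinger j)
      rw [taylor_wirtinger hs, h0, map_zero, mul_zero] at h1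
      exact h1
    have hd : deriv (fun s : ℂ => f (s • z)) =ᶠ[𝓝 0] fun s => f' (s • z) := by
      have hmem : ∀ᶠ s : ℂ in 𝓝 0, s • z ∈ ball (0 : σ → ℂ) R := by
        refine ContinuousAt.preimage_mem_nhds (by fun_prop) (isOpen_ball.mem_nhds ?_)
        simpa using hR
      filter_upwards [hmem] with s hs
      have h1 : HasFDerivAt f (fderiv ℂ f (s • z)) (s • z) :=
        ((hf _ hs).differentiableAt (isOpen_ball.mem_nhds hs)).hasFDerivAt
      have h2 : HasDerivAt (fun s : ℂ => s • z) z s := by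
        simpa using (hasDerivAt_id s).smul_const z
      have h3 : HasDerivAt (fun s : ℂ => f (s • z)) (fderiv ℂ f (s • z) z) s :=
        h1.comp_hasDerivAt s h2
      rw [h3.deriv]
      have h4 : ∀ L : (σ → ℂ) →L[ℂ] ℂ, L z = ∑ j, z j * L (Pi.single j 1) := fun L => by
        conv_lhs => rw [pi_eq_sum_univ' z, map_sum]
        simp only [map_smul, smul_eq_mul]
      rw [h4]
      exact Finset.sum_congr rfl fun j _ => by rw [hf.wirtinger_eqOn isOpen_ball j hs]
    rw [iteratedDeriv_succ', hd.iteratedDeriv_eq]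
    exact ih hf' hzero

/-- A holomorphic function with vanishing Taylor series vanishes. -/
theorem eq_zero_of_taylor_eq_zero {R : ℝ} (hf : DifferentiableOn ℂ f (ball 0 R))
    (h0 : taylor f = 0) {z : σ → ℂ} (hz : z ∈ ball 0 R) : f z = 0 := by
  have hzR := mem_ball_zero_iff.1 hz
  have hR : 0 < R := (norm_nonneg z).trans_lt hzR
  by_cases hz0 : z = 0
  · rw [hz0, ← constantCoeff_taylor f, h0, map_zero]
  have hz' : 0 < ‖z‖ := norm_pos_iff.2 hz0
  have hg : DifferentiableOn ℂ (fun s : ℂ => f (s • z)) (ball 0 (R / ‖z‖)) := by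
    refine hf.comp (by fun_prop) fun s hs => ?_
    rw [mem_ball_zero_iff] at hs ⊢
    rw [norm_smul]
    exact (lt_div_iff₀ hz').1 hs
  have h1 := Complex.taylorSeries_eq_on_ball' (z := 1) (by
    rw [mem_ball_zero_iff, norm_one]
    exact (one_lt_div hz').2 hzR) hg
  simp only [iteratedDeriv_line_eq_zero hR hf h0 z, mul_zero, zero_mul, tsum_zero, one_smul] at h1
  exact h1.symm

theorem norm_iterWirtinger_le (hU : IsOpen U) (hf : DifferentiableOn ℂ f U) {r C δ : ℝ}
    (hrU : closedBall 0 r ⊆ U) (hC : ∀ z ∈ closedBall 0 r, ‖f z‖ ≤ C) (hδ : 0 < δ) (l : List σ)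
    {z : σ → ℂ} (hz : ‖z‖ ≤ r - l.length * δ) : ‖iterWirtinger l f z‖ ≤ C / δ ^ l.length := by
  induction l generalizing z with
  | nil => simpa using! hC z (by simpa using hz)
  | cons j l ih =>
    have hsub : closedBall z δ ⊆ closedBall 0 (r - l.length * δ) := by
      refine closedBall_subset_closedBall' ?_
      rw [dist_zero_right]
      rw [List.length_cons] at hz
      push_cast at hz
      linarith
    have hsub' : closedBall z δ ⊆ U := by
      refine hsub.trans (Set.Subset.trans (closedBall_subset_closedBall ?_) hrU)
      nlinarith [l.length.cast_nonneg (α := ℝ)]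
    have h1 := norm_fderiv_le_of_norm_le hU (hf.iterWirtinger hU l) hδ hsub'
      fun w hw => ih (mem_closedBall_zero_iff.1 (hsub hw))
    change ‖wirtinger j (iterWirtinger l f) z‖ ≤ _
    rw [(hf.iterWirtinger hU l).wirtinger_eqOn hU j (hsub' (mem_closedBall_self hδ.le))]
    refine (ContinuousLinearMap.le_opNorm _ _).trans ?_
    rw [Pi.norm_single, norm_one, mul_one]
    refine h1.trans (le_of_eq ?_)
    rw [List.length_cons, pow_succ, div_div]

theorem monWeight_injective {p : σ → ℕ} (hp : ∀ i, (p i).Prime) (hpi : Function.Injective p) :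
    Function.Injective (monWeight p) := by
  intro α β h
  ext i
  rw [← factorization_monWeight hp hpi, ← factorization_monWeight hp hpi, h]

theorem norm_coeff_taylor_le (hU : IsOpen U) (hf : DifferentiableOn ℂ f U) {r C : ℝ} (hr : 0 < r)
    (hrU : closedBall 0 r ⊆ U) (hC : ∀ z ∈ closedBall 0 r, ‖f z‖ ≤ C) (α : σ →₀ ℕ) :
    ‖MvPowerSeries.coeff α (taylor f)‖ ≤
      C * (Real.exp (Fintype.card σ) / r) ^ α.degree := by
  by_cases hα : α = 0
  · subst hα
    rw [constantCoeff_taylor, map_zero, pow_zero, mul_one]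
    exact hC 0 (mem_closedBall_self hr.le)
  have hC0 : 0 ≤ C := (norm_nonneg _).trans (hC 0 (mem_closedBall_self hr.le))
  set k := α.degree with hk
  have hk0 : (0 : ℝ) < k := by
    rw [Nat.cast_pos, Nat.pos_iff_ne_zero, hk]
    exact fun h => hα ((Finsupp.degree_eq_zero_iff α).1 h)
  have hlen : (Finsupp.toMultiset α).toList.length = k := by
    rw [Multiset.length_toList, Finsupp.card_toMultiset, hk]
    rfl
  have h1 := norm_iterWirtinger_le hU hf hrU hC (δ := r / k) (by positivity)
    (Finsupp.toMultiset α).toList (z := 0) (by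
      rw [hlen, norm_zero, mul_div_cancel₀ _ hk0.ne', sub_self])
  rw [hlen] at h1
  have hdeg : α.degree = ∑ i, α i := Finsupp.degree_eq_sum α
  have h2 : (k : ℝ) ^ k / ∏ i, ((α i).factorial : ℝ) ≤ Real.exp (Fintype.card σ) ^ k := by
    calc (k : ℝ) ^ k / ∏ i, ((α i).factorial : ℝ) = ∏ i, (k : ℝ) ^ α i / (α i).factorial := by
          rw [Finset.prod_div_distrib, Finset.prod_pow_eq_pow_sum, ← hdeg]
      _ ≤ ∏ _i : σ, Real.exp k := Finset.prod_le_prod (fun i _ => by positivity)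
          fun i _ => Real.pow_div_factorial_le_exp _ hk0.le _
      _ = Real.exp (Fintype.card σ) ^ k := by
          rw [Finset.prod_const, Finset.card_univ, ← Real.exp_nat_mul, ← Real.exp_nat_mul,
            mul_comm]
  have hprod : (0 : ℝ) < ∏ i, ((α i).factorial : ℝ) :=
    Finset.prod_pos fun i _ => by exact_mod_cast Nat.factorial_pos _
  have h3 : ‖∏ i, ((α i).factorial : ℂ)‖ = ∏ i, ((α i).factorial : ℝ) := by
    simp [norm_prod]
  rw [coeff_taylor, norm_div, h3]
  calc _ ≤ C / (r / k) ^ k / ∏ i, ((α i).factorial : ℝ) := by gcongr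
    _ = C * ((k : ℝ) ^ k / ∏ i, ((α i).factorial : ℝ)) / r ^ k := by
      rw [div_pow]
      field_simp
    _ ≤ C * (Real.exp (Fintype.card σ) ^ k) / r ^ k := by gcongr
    _ = _ := by rw [div_pow, mul_div_assoc]

theorem exists_absConv_taylor {p : σ → ℕ} (hp : ∀ i, (p i).Prime) (hpi : Function.Injective p)
    (hU : IsOpen U) (hf : DifferentiableOn ℂ f U) (h0 : 0 ∈ U) : ∃ t, AbsConv p t (taylor f) := by
  obtain ⟨r, hr, hrU⟩ := nhds_basis_closedBall.mem_iff.1 (hU.mem_nhds h0)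
  obtain ⟨C, hC⟩ := (isCompact_closedBall (0 : σ → ℂ) r).exists_bound_of_continuousOn
    (hf.continuousOn.mono hrU)
  have hC0 : 0 ≤ C := (norm_nonneg _).trans (hC 0 (mem_closedBall_self hr.le))
  obtain ⟨s, hs⟩ := pow_unbounded_of_one_lt (Real.exp (Fintype.card σ) / r) one_lt_two
  refine ⟨s + 2, ?_⟩
  have hsum : Summable fun α : σ →₀ ℕ => C * ((monWeight p α : ℝ) ^ 2)⁻¹ :=
    ((Real.summable_nat_pow_inv.2 one_lt_two).comp_injective
      (monWeight_injective hp hpi)).mul_left C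
  refine Summable.of_nonneg_of_le (fun α => by positivity) (fun α => ?_) hsum
  have hw : (0 : ℝ) < monWeight p α := by exact_mod_cast monWeight_pos hp α
  have h1 : (2 : ℝ) ^ α.degree ≤ monWeight p α := by
    exact_mod_cast two_pow_degree_le_monWeight hp α
  have h2 : (Real.exp (Fintype.card σ) / r) ^ α.degree ≤ (monWeight p α : ℝ) ^ s := by
    calc _ ≤ ((2 : ℝ) ^ s) ^ α.degree := by gcongr
      _ = ((2 : ℝ) ^ α.degree) ^ s := by rw [← pow_mul, ← pow_mul, mul_comm]
      _ ≤ _ := by gcongr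
  have h3 := (norm_coeff_taylor_le hU hf hr hrU hC α).trans (mul_le_mul_of_nonneg_left h2 hC0)
  calc _ ≤ C * (monWeight p α : ℝ) ^ s * ((monWeight p α : ℝ)⁻¹) ^ (s + 2) := by gcongr
    _ = _ := by
      rw [pow_add, inv_pow, inv_pow]
      field_simp

end HolomorphicTaylor

section Evaluation

open Filter Topology Metric
open scoped ContDiff

variable {σ : Type*} [Fintype σ]

/-- The monomial function `z ↦ z ^ α`. -/
def monFun (α : σ →₀ ℕ) (z : σ → ℂ) : ℂ := ∏ i, z i ^ α i

/-- The sum of a power series. -/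
noncomputable def seriesSum (a : MvPowerSeries σ ℂ) (z : σ → ℂ) : ℂ :=
  ∑' α, MvPowerSeries.coeff α a * monFun α z

/-- A polydisc well inside the domain of convergence of series satisfying `AbsConv p t`. -/
def smallPolydisc (p : σ → ℕ) (t : ℕ) : Set (σ → ℂ) :=
  Set.univ.pi fun i => ball 0 (((p i : ℝ)⁻¹) ^ t / 2)

variable {p : σ → ℕ} {t : ℕ}

theorem isOpen_smallPolydisc : IsOpen (smallPolydisc p t) :=
  isOpen_set_pi Set.finite_univ fun _ _ => isOpen_ball

theorem convex_smallPolydisc : Convex ℝ (smallPolydisc p t) :=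
  convex_pi fun _ _ => convex_ball _ _

theorem zero_mem_smallPolydisc (hp : ∀ i, (p i).Prime) : 0 ∈ smallPolydisc p t := by
  intro i _
  have : (0 : ℝ) < p i := by exact_mod_cast (hp i).pos
  rw [Pi.zero_apply]
  exact mem_ball_self (by positivity)

theorem differentiable_monFun (α : σ →₀ ℕ) : Differentiable ℂ (monFun α) := by
  unfold monFun
  fun_prop

theorem norm_monFun_le (α : σ →₀ ℕ) {z : σ → ℂ} (hz : ∀ i, ‖z i‖ ≤ ((p i : ℝ)⁻¹) ^ t) :
    ‖monFun α z‖ ≤ ((monWeight p α : ℝ)⁻¹) ^ t := by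
  rw [monFun, norm_prod, monWeight]
  push_cast
  rw [← Finset.prod_inv_distrib, ← Finset.prod_pow]
  refine Finset.prod_le_prod (fun i _ => norm_nonneg _) fun i _ => ?_
  rw [norm_pow, ← inv_pow, pow_right_comm]
  exact pow_le_pow_left₀ (norm_nonneg _) (hz i) _

theorem monFun_zero (α : σ →₀ ℕ) (hα : α ≠ 0) : monFun α 0 = 0 := by
  obtain ⟨i, hi⟩ := Finsupp.ne_iff.1 hα
  exact Finset.prod_eq_zero (Finset.mem_univ i) (zero_pow hi)

theorem seriesSum_zero (a : MvPowerSeries σ ℂ) : seriesSum a 0 = MvPowerSeries.coeff 0 a := by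
  rw [seriesSum, tsum_eq_single 0 fun α hα => by rw [monFun_zero α hα, mul_zero]]
  simp [monFun]

theorem exists_norm_fderiv_monFun_le (hp : ∀ i, (p i).Prime) : ∃ δ > 0, ∀ α,
    ∀ z ∈ smallPolydisc p t, ‖fderiv ℂ (monFun α) z‖ ≤ ((monWeight p α : ℝ)⁻¹) ^ t / δ := by
  have hρ : ∀ i, (0 : ℝ) < ((p i : ℝ)⁻¹) ^ t / 2 := fun i => by
    have : (0 : ℝ) < p i := by exact_mod_cast (hp i).pos
    positivity
  obtain ⟨δ, hδ, hδ0⟩ : ∃ δ : ℝ, (∀ i, δ < ((p i : ℝ)⁻¹) ^ t / 2) ∧ 0 < δ := by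
    have h1 : ∀ᶠ δ : ℝ in 𝓝[>] 0, ∀ i, δ < ((p i : ℝ)⁻¹) ^ t / 2 :=
      eventually_all.2 fun i => nhdsWithin_le_nhds (eventually_lt_nhds (hρ i))
    exact (h1.and self_mem_nhdsWithin).exists
  refine ⟨δ, hδ0, fun α z hz => norm_fderiv_le_of_norm_le isOpen_univ
    (differentiable_monFun α).differentiableOn hδ0 (Set.subset_univ _)
    fun w hw => norm_monFun_le α fun i => ?_⟩
  have h1 : ‖z i‖ < _ := mem_ball_zero_iff.1 (hz i trivial)
  have h2 : ‖w i - z i‖ ≤ δ := (norm_le_pi_norm (w - z) i).trans (mem_closedBall_iff_norm.1 hw)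
  have h3 : ‖w i‖ ≤ ‖w i - z i‖ + ‖z i‖ := by
    simpa using norm_add_le (w i - z i) (z i)
  linarith [hδ i]

theorem hasFDerivAt_seriesSum (hp : ∀ i, (p i).Prime) {a : MvPowerSeries σ ℂ}
    (ha : AbsConv p t a) {z : σ → ℂ} (hz : z ∈ smallPolydisc p t) :
    (Summable fun α => MvPowerSeries.coeff α a • fderiv ℂ (monFun α) z) ∧
    HasFDerivAt (seriesSum a) (∑' α, MvPowerSeries.coeff α a • fderiv ℂ (monFun α) z) z := by
  obtain ⟨δ, hδ, hb⟩ := exists_norm_fderiv_monFun_le (t := t) hp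
  have hbound : ∀ α, ∀ y ∈ smallPolydisc p t,
      ‖MvPowerSeries.coeff α a • fderiv ℂ (monFun α) y‖ ≤
        ‖MvPowerSeries.coeff α a‖ * ((monWeight p α : ℝ)⁻¹) ^ t * δ⁻¹ := by
    intro α y hy
    rw [norm_smul, mul_assoc, ← div_eq_mul_inv]
    exact mul_le_mul_of_nonneg_left (hb α y hy) (norm_nonneg _)
  have hsum : Summable fun α => ‖MvPowerSeries.coeff α a‖ * ((monWeight p α : ℝ)⁻¹) ^ t * δ⁻¹ :=
    Summable.mul_right _ ha
  refine ⟨Summable.of_norm_bounded hsum fun α => hbound α z hz, ?_⟩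
  refine hasFDerivAt_tsum_of_isPreconnected hsum isOpen_smallPolydisc
    convex_smallPolydisc.isPreconnected
    (fun α y _ => ((differentiable_monFun α) y).hasFDerivAt.const_mul _) hbound
    (zero_mem_smallPolydisc hp) ?_ hz
  exact summable_of_ne_finset_zero (s := {0}) fun α hα => by
    rw [monFun_zero α (by simpa using hα), mul_zero]

variable [DecidableEq σ]

theorem fderiv_monFun (α : σ →₀ ℕ) (z : σ → ℂ) (j : σ) :
    fderiv ℂ (monFun α) z (Pi.single j 1) =
      (∏ i ∈ Finset.univ.erase j, z i ^ α i) * (α j * z j ^ (α j - 1)) := by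
  have hi : ∀ i, HasFDerivAt (fun z : σ → ℂ => z i)
      (ContinuousLinearMap.proj (R := ℂ) (φ := fun _ => ℂ) i) z := fun i => hasFDerivAt_apply i z
  have h : HasFDerivAt (monFun α) _ z := HasFDerivAt.finsetProd (u := Finset.univ)
    (g := fun i (z : σ → ℂ) => z i ^ α i) fun i _ => (hi i).pow (α i)
  rw [h.fderiv]
  simp only [_root_.sum_apply, _root_.smul_apply,
    ContinuousLinearMap.proj_apply, smul_eq_mul]
  rw [Finset.sum_eq_single j]
  · simp
  · intro i _ hij
    simp [Pi.single_eq_of_ne hij]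
  · simp

theorem fderiv_monFun_add_single (α : σ →₀ ℕ) (z : σ → ℂ) (j : σ) :
    fderiv ℂ (monFun (α + Finsupp.single j 1)) z (Pi.single j 1) = (α j + 1) * monFun α z := by
  rw [fderiv_monFun, monFun, ← Finset.mul_prod_erase _ _ (Finset.mem_univ j)]
  have h1 : ∏ i ∈ Finset.univ.erase j, z i ^ (α + Finsupp.single j 1 : σ →₀ ℕ) i =
      ∏ i ∈ Finset.univ.erase j, z i ^ α i := by
    refine Finset.prod_congr rfl fun i hi => ?_
    rw [Finsupp.add_apply, Finsupp.single_eq_of_ne (Finset.ne_of_mem_erase hi), add_zero]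
  rw [h1, Finsupp.add_apply, Finsupp.single_eq_same, Nat.add_sub_cancel]
  push_cast
  ring

theorem fderiv_seriesSum (hp : ∀ i, (p i).Prime) {a : MvPowerSeries σ ℂ} (ha : AbsConv p t a)
    {z : σ → ℂ} (hz : z ∈ smallPolydisc p t) (j : σ) :
    fderiv ℂ (seriesSum a) z (Pi.single j 1) = seriesSum (MvPowerSeries.pderiv ℂ j a) z := by
  obtain ⟨hs, hd⟩ := hasFDerivAt_seriesSum hp ha hz
  have hinj : Function.Injective fun α : σ →₀ ℕ => α + Finsupp.single j 1 :=
    add_left_injective _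
  have h1 := (ContinuousLinearMap.apply ℂ ℂ (Pi.single j 1 : σ → ℂ)).map_tsum hs
  simp only [ContinuousLinearMap.apply_apply, _root_.smul_apply, smul_eq_mul] at h1
  rw [hd.fderiv, h1, seriesSum, ← hinj.tsum_eq]
  · refine tsum_congr fun α => ?_
    rw [fderiv_monFun_add_single, MvPowerSeries.coeff_pderiv]
    ring
  · intro α hα
    have hαj : α j ≠ 0 := fun h => hα (by simp only [fderiv_monFun, h]; simp)
    refine ⟨α - Finsupp.single j 1, tsub_add_cancel_of_le ?_⟩
    rw [Finsupp.single_le_iff]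
    omega

theorem AbsConv.pderiv (hp : ∀ i, (p i).Prime) {a : MvPowerSeries σ ℂ} (ha : AbsConv p t a)
    (j : σ) : AbsConv p (t + 1) (MvPowerSeries.pderiv ℂ j a) := by
  have hinj : Function.Injective fun α : σ →₀ ℕ => α + Finsupp.single j 1 :=
    add_left_injective _
  have hs := (ha.comp_injective hinj).mul_right ((p j : ℝ) ^ t)
  refine Summable.of_nonneg_of_le (fun α => by positivity) (fun α => ?_) hs
  have hpj : (0 : ℝ) < p j := by exact_mod_cast (hp j).pos
  have hw : (0 : ℝ) < monWeight p α := by exact_mod_cast monWeight_pos hp α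
  have h1 : (α j + 1 : ℝ) ≤ monWeight p α := by
    have h2 : α j + 1 ≤ monWeight p α := by
      refine le_trans ?_ (two_pow_degree_le_monWeight hp α)
      exact (Nat.succ_le_of_lt Nat.lt_two_pow_self).trans
        (Nat.pow_le_pow_right two_pos (Finsupp.le_degree j α))
    exact_mod_cast h2
  have h2 : monWeight p (Finsupp.single j 1) = p j := by
    rw [monWeight, Finset.prod_eq_single j]
    · simp
    · intro i _ hij
      simp [Finsupp.single_eq_of_ne hij]
    · simp
  have h3 : ‖(α j + 1 : ℂ)‖ = α j + 1 := by
    exact_mod_cast Complex.norm_natCast (α j + 1)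
  simp only [Function.comp]
  rw [MvPowerSeries.coeff_pderiv, norm_mul, h3, monWeight_add, h2]
  push_cast
  rw [mul_inv, mul_pow, inv_pow (p j : ℝ)]
  have h4 : ‖MvPowerSeries.coeff (α + Finsupp.single j 1) a‖ *
      (((monWeight p α : ℝ)⁻¹) ^ t * ((p j : ℝ) ^ t)⁻¹) * (p j : ℝ) ^ t =
      ‖MvPowerSeries.coeff (α + Finsupp.single j 1) a‖ * ((monWeight p α : ℝ)⁻¹) ^ t := by
    field_simp
  rw [h4, pow_succ]
  have h5 : (α j + 1 : ℝ) * (monWeight p α : ℝ)⁻¹ ≤ 1 := by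
    rw [← div_eq_mul_inv]
    exact (div_le_one hw).2 h1
  calc _ = ‖MvPowerSeries.coeff (α + Finsupp.single j 1) a‖ * ((monWeight p α : ℝ)⁻¹) ^ t *
        ((α j + 1 : ℝ) * (monWeight p α : ℝ)⁻¹) := by ring
    _ ≤ _ := mul_le_of_le_one_right (by positivity) h5

theorem differentiableOn_seriesSum (hp : ∀ i, (p i).Prime) {a : MvPowerSeries σ ℂ}
    (ha : AbsConv p t a) : DifferentiableOn ℂ (seriesSum a) (smallPolydisc p t) := fun _ hz =>
  (hasFDerivAt_seriesSum hp ha hz).2.differentiableAt.differentiableWithinAt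

theorem taylor_seriesSum (hp : ∀ i, (p i).Prime) {a : MvPowerSeries σ ℂ} (ha : AbsConv p t a) :
    taylor (seriesSum a) = a := by
  ext α
  induction α using Finsupp.induction_add_single generalizing a t with
  | h0 => rw [constantCoeff_taylor, seriesSum_zero]
  | h α j ih =>
    apply coeff_add_single_eq
    have hd := differentiableOn_seriesSum hp ha
    have hmem := isOpen_smallPolydisc.mem_nhds (zero_mem_smallPolydisc (t := t) hp)
    rw [← taylor_wirtinger (hd.contDiffAt_real isOpen_smallPolydisc (zero_mem_smallPolydisc hp)),
      ← ih (ha.pderiv hp j), taylor_congr]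
    filter_upwards [hmem] with z hz
    exact (hd.wirtinger_eqOn isOpen_smallPolydisc j hz).trans (fderiv_seriesSum hp ha hz j)

end Evaluation

section Intertwiner

/-- Two finite families of pairwise distinct primes. -/
theorem exists_distinct_primes (σ κ : Type*) [Finite σ] [Finite κ] :
    ∃ (p : σ → ℕ) (q : κ → ℕ), (∀ i, (p i).Prime) ∧ (∀ k, (q k).Prime) ∧
      Function.Injective p ∧ Function.Injective q ∧ ∀ i k, p i ≠ q k := by
  obtain ⟨e, he⟩ := Countable.exists_injective_nat (σ ⊕ κ)
  have hinj : Function.Injective fun x => Nat.nth Nat.Prime (e x) :=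
    (Nat.nth_injective Nat.infinite_setOfPred_prime).comp he
  exact ⟨fun i => Nat.nth Nat.Prime (e (.inl i)), fun k => Nat.nth Nat.Prime (e (.inr k)),
    fun i => Nat.prime_nth_prime _, fun k => Nat.prime_nth_prime _,
    hinj.comp Sum.inl_injective, hinj.comp Sum.inr_injective,
    fun i k h => Sum.inl_ne_inr (hinj h)⟩

theorem coeff_mul_eq_zero_of_degree_lt {σ : Type*} {K : ℕ} {a : MvPowerSeries σ ℂ}
    (ha : ∀ α : σ →₀ ℕ, α.degree < K → MvPowerSeries.coeff α a = 0) (b : MvPowerSeries σ ℂ)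
    {α : σ →₀ ℕ} (hα : α.degree < K) : MvPowerSeries.coeff α (a * b) = 0 := by
  classical
  rw [MvPowerSeries.coeff_mul]
  refine Finset.sum_eq_zero fun x hx => ?_
  rw [ha x.1, zero_mul]
  have h : x.1.degree + x.2.degree = α.degree := by
    rw [← map_add, Finset.HasAntidiagonal.mem_antidiagonal.1 hx]
  omega

/-- The truncation of a power series to degrees below `K`. -/
theorem exists_polynomial_coeff_eq {σ : Type*} [Finite σ] (K : ℕ) (a : MvPowerSeries σ ℂ) :
    ∃ P : MvPolynomial σ ℂ, ∀ α : σ →₀ ℕ, α.degree < K →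
      MvPowerSeries.coeff α (P : MvPowerSeries σ ℂ) = MvPowerSeries.coeff α a := by
  classical
  have hfin : {α : σ →₀ ℕ | α.degree < K}.Finite := Finsupp.finite_of_degree_lt K
  refine ⟨MvPowerSeries.truncFinset ℂ hfin.toFinset a, fun α hα => ?_⟩
  rw [MvPolynomial.coeff_coe, MvPowerSeries.coeff_truncFinset_of_mem _ (by simpa using hα)]

variable {σ ι : Type*} [Fintype σ] [Fintype ι]

theorem AbsConv.matrix_mul {p : σ → ℕ} (hp : ∀ i, (p i).Prime)
    {A B : Matrix ι ι (MvPowerSeries σ ℂ)} (hA : ∀ i j, ∃ t, AbsConv p t (A i j))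
    (hB : ∀ i j, ∃ t, AbsConv p t (B i j)) (i j : ι) : ∃ t, AbsConv p t ((A * B) i j) := by
  have h1 := eventually_absConv hp (F := fun k => A i k) fun k => hA i k
  have h2 := eventually_absConv hp (F := fun k => B k j) fun k => hB k j
  obtain ⟨t, h1, h2⟩ := (h1.and h2).exists
  exact ⟨t, AbsConv.sum _ fun k _ => (h1 k).mul (h2 k)⟩

/-- The vectors `H * B - A * H` with `H` convergent and vanishing at the origin. -/
def commutatorSubgroup {p : σ → ℕ} (hp : ∀ i, (p i).Prime)
    (A B : Matrix ι ι (MvPowerSeries σ ℂ)) : AddSubgroup (ι × ι → MvPowerSeries σ ℂ) where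
  carrier := {G | ∃ H : Matrix ι ι (MvPowerSeries σ ℂ), (∀ i j, ∃ t, AbsConv p t (H i j)) ∧
    (∀ i j, MvPowerSeries.coeff 0 (H i j) = 0) ∧ ∀ k, G k = (H * B - A * H) k.1 k.2}
  zero_mem' := ⟨0, fun i j => ⟨0, by simpa using AbsConv.C p 0 0⟩, by simp, by simp⟩
  add_mem' := by
    rintro G G' ⟨H, h1, h2, h3⟩ ⟨H', h1', h2', h3'⟩
    refine ⟨H + H', fun i j => ?_, fun i j => by
      rw [Matrix.add_apply, map_add, h2, h2', add_zero], fun k => ?_⟩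
    · obtain ⟨t, ht⟩ := h1 i j
      obtain ⟨t', ht'⟩ := h1' i j
      exact ⟨max t t', (ht.mono hp (le_max_left _ _)).add (ht'.mono hp (le_max_right _ _))⟩
    · have h : (H + H') * B - A * (H + H') = (H * B - A * H) + (H' * B - A * H') := by
        noncomm_ring
      rw [Pi.add_apply, h3, h3', h, Matrix.add_apply]
  neg_mem' := by
    rintro G ⟨H, h1, h2, h3⟩
    refine ⟨-H, fun i j => (h1 i j).imp fun t ht => ht.neg, fun i j => by
      rw [Matrix.neg_apply, map_neg, h2, neg_zero], fun k => ?_⟩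
    have h : -H * B - A * -H = -(H * B - A * H) := by noncomm_ring
    rw [Pi.neg_apply, h3, h, Matrix.neg_apply]

/-- A formal intertwiner of convergent matrices can be replaced by a convergent one. -/
theorem exists_convergent_intertwiner {p : σ → ℕ} {q : ι × ι → ℕ} (hp : ∀ i, (p i).Prime)
    (hq : ∀ k, (q k).Prime) (hpi : Function.Injective p) (hqi : Function.Injective q)
    (hpq : ∀ i k, p i ≠ q k) {A B T : Matrix ι ι (MvPowerSeries σ ℂ)}
    (hA : ∀ i j, ∃ t, AbsConv p t (A i j)) (hB : ∀ i j, ∃ t, AbsConv p t (B i j))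
    (hT : T * B = A * T) :
    ∃ (t : ℕ) (H : Matrix ι ι (MvPowerSeries σ ℂ)), (∀ i j, AbsConv p t (H i j)) ∧
      H * B = A * H ∧ ∀ i j, MvPowerSeries.coeff 0 (H i j) = MvPowerSeries.coeff 0 (T i j) := by
  let Φ : Matrix ι ι (MvPowerSeries σ ℂ) :=
    fun i j => MvPowerSeries.C (MvPowerSeries.coeff 0 (T i j))
  have hΦ0 : ∀ i j, MvPowerSeries.coeff 0 (Φ i j) = MvPowerSeries.coeff 0 (T i j) := by
    simp [Φ]
  have hconv : ∀ H : Matrix ι ι (MvPowerSeries σ ℂ), (∀ i j, ∃ t, AbsConv p t (H i j)) →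
      ∀ i j, ∃ t, AbsConv p t ((H * B - A * H) i j) := by
    intro H hH i j
    obtain ⟨t, ht⟩ := AbsConv.matrix_mul hp hH hB i j
    obtain ⟨t', ht'⟩ := AbsConv.matrix_mul hp hA hH i j
    exact ⟨max t t', (ht.mono hp (le_max_left _ _)).sub (ht'.mono hp (le_max_right _ _))⟩
  have hmem : (fun k : ι × ι => (-(Φ * B - A * Φ)) k.1 k.2) ∈ commutatorSubgroup hp A B := by
    refine mem_of_forall_exists_coeff_eq hp hq hpi hqi hpq _ ?_ ?_ _ ?_ ?_
    · rintro F ⟨H, h1, -, h3⟩ k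
      rw [h3]
      exact hconv H h1 _ _
    · rintro a t ha F ⟨H, h1, h2, h3⟩
      refine ⟨a • H, fun i j => ?_, fun i j => ?_, fun k => ?_⟩
      · obtain ⟨t', ht'⟩ := h1 i j
        exact ⟨max t t', (ha.mono hp (le_max_left _ _)).mul (ht'.mono hp (le_max_right _ _))⟩
      · simpa using Or.inr (h2 i j)
      · rw [Matrix.smul_mul, Matrix.mul_smul, ← smul_sub, Matrix.smul_apply, Pi.smul_apply, h3]
    · intro k
      obtain ⟨t, ht⟩ := hconv Φ (fun i j => ⟨0, AbsConv.C p 0 _⟩) k.1 k.2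
      exact ⟨t, ht.neg⟩
    · intro K
      choose P hP using fun i j => exists_polynomial_coeff_eq (K + 1) (T i j)
      let Q : Matrix ι ι (MvPowerSeries σ ℂ) := fun i j => (P i j : MvPowerSeries σ ℂ)
      refine ⟨fun k => ((Q - Φ) * B - A * (Q - Φ)) k.1 k.2, ⟨Q - Φ, fun i j => ?_, fun i j => ?_,
        fun k => rfl⟩, fun γ hγ => ?_⟩
      · exact ⟨0, (AbsConv.coe p 0 (P i j)).sub (AbsConv.C p 0 _)⟩
      · rw [Matrix.sub_apply, map_sub, hΦ0, sub_eq_zero]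
        exact hP i j 0 (by simp)
      · have hR : ∀ i j, ∀ α : σ →₀ ℕ, α.degree < K →
            MvPowerSeries.coeff α ((T - Q) i j) = 0 := fun i j α hα => by
          rw [Matrix.sub_apply, map_sub, sub_eq_zero]
          exact (hP i j α (hα.trans K.lt_succ_self)).symm
        have h : -(Φ * B - A * Φ) = (Q - Φ) * B - A * (Q - Φ) +
            ((T - Q) * B - A * (T - Q)) - (T * B - A * T) := by
          noncomm_ring
        rw [vecCoeff, vecCoeff, h, hT, sub_self, sub_zero, Matrix.add_apply, map_add,
          add_eq_left, Matrix.sub_apply, map_sub, Matrix.mul_apply, Matrix.mul_apply, map_sum,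
          map_sum, Finset.sum_eq_zero, Finset.sum_eq_zero, sub_zero]
        · intro i _
          rw [mul_comm]
          exact coeff_mul_eq_zero_of_degree_lt (hR _ _) _ hγ
        · exact fun i _ => coeff_mul_eq_zero_of_degree_lt (hR _ _) _ hγ
  obtain ⟨H, h1, h2, h3⟩ := hmem
  obtain ⟨t, ht⟩ := (eventually_absConv hp (F := fun k : ι × ι => H k.1 k.2)
    fun k => h1 k.1 k.2).exists
  refine ⟨t, H + Φ, fun i j => (ht (i, j)).add (AbsConv.C p t _), ?_, fun i j => ?_⟩
  · have h : -(Φ * B - A * Φ) = H * B - A * H := by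
      ext1 i j
      exact h3 (i, j)
    have h' : (H + Φ) * B - A * (H + Φ) = (H * B - A * H) + (Φ * B - A * Φ) := by noncomm_ring
    rw [← sub_eq_zero, h', ← h, neg_add_cancel]
  · rw [Matrix.add_apply, map_add, h2, zero_add, hΦ0]

end Intertwiner

section Spallek

open Topology Metric
open scoped ContDiff

variable {σ ι : Type*} [Fintype σ] [DecidableEq σ] [Fintype ι]

theorem taylor_matrix_mul {F G : (σ → ℂ) → Matrix ι ι ℂ}
    (hF : ∀ i j, ContDiffAt ℝ ∞ (fun z => F z i j) 0)
    (hG : ∀ i j, ContDiffAt ℝ ∞ (fun z => G z i j) 0) (i j : ι) :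
    taylor (fun z => (F z * G z) i j) =
      ((Matrix.of fun i j => taylor fun z => F z i j) *
        (Matrix.of fun i j => taylor fun z => G z i j)) i j := by
  simp only [Matrix.mul_apply, Matrix.of_apply]
  rw [taylor_sum _ fun k _ => (hF i k).mul (hG k j)]
  exact Finset.sum_congr rfl fun k _ => taylor_mul (hF i k) (hG k j)

theorem exists_holomorphic_intertwiner {V : Set (σ → ℂ)} (hV : IsOpen V) (h0 : 0 ∈ V)
    {A B T : (σ → ℂ) → Matrix ι ι ℂ} (hA : ∀ i j, DifferentiableOn ℂ (fun z => A z i j) V)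
    (hB : ∀ i j, DifferentiableOn ℂ (fun z => B z i j) V)
    (hT : ∀ i j, ContDiffAt ℝ ∞ (fun z => T z i j) 0) (hTAB : ∀ z ∈ V, T z * B z = A z * T z) :
    ∃ R > 0, ball 0 R ⊆ V ∧ ∃ H : (σ → ℂ) → Matrix ι ι ℂ,
      (∀ i j, DifferentiableOn ℂ (fun z => H z i j) (ball 0 R)) ∧
      (∀ z ∈ ball 0 R, H z * B z = A z * H z) ∧ H 0 = T 0 := by
  obtain ⟨p, q, hp, hq, hpi, hqi, hpq⟩ := exists_distinct_primes σ (ι × ι)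
  have hA0 := fun i j => (hA i j).contDiffAt_real hV h0
  have hB0 := fun i j => (hB i j).contDiffAt_real hV h0
  obtain ⟨t, H, hH, hHAB, hH0⟩ := exists_convergent_intertwiner hp hq hpi hqi hpq
    (A := Matrix.of fun i j => taylor fun z => A z i j)
    (B := Matrix.of fun i j => taylor fun z => B z i j)
    (T := Matrix.of fun i j => taylor fun z => T z i j)
    (fun i j => exists_absConv_taylor hp hpi hV (hA i j) h0)
    (fun i j => exists_absConv_taylor hp hpi hV (hB i j) h0) (by
      ext1 i j
      rw [← taylor_matrix_mul hT hB0, ← taylor_matrix_mul hA0 hT]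
      apply taylor_congr
      filter_upwards [hV.mem_nhds h0] with z hz
      rw [hTAB z hz])
  have hopen := (isOpen_smallPolydisc (p := p) (t := t)).inter hV
  obtain ⟨R, hR, hball⟩ := isOpen_iff.1 hopen 0 ⟨zero_mem_smallPolydisc hp, h0⟩
  let S : (σ → ℂ) → Matrix ι ι ℂ := fun z => Matrix.of fun i j => seriesSum (H i j) z
  have hS : ∀ i j, DifferentiableOn ℂ (fun z => S z i j) (ball 0 R) := fun i j =>
    (differentiableOn_seriesSum hp (hH i j)).mono fun z hz => (hball hz).1
  have hS0 := fun i j => (hS i j).contDiffAt_real isOpen_ball (mem_ball_self hR)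
  have hStaylor : (Matrix.of fun i j => taylor fun z => S z i j) = H := by
    ext1 i j
    exact taylor_seriesSum hp (hH i j)
  have hAR : ∀ i j, DifferentiableOn ℂ (fun z => A z i j) (ball 0 R) := fun i j =>
    (hA i j).mono fun z hz => (hball hz).2
  have hBR : ∀ i j, DifferentiableOn ℂ (fun z => B z i j) (ball 0 R) := fun i j =>
    (hB i j).mono fun z hz => (hball hz).2
  have hmul : ∀ F G : (σ → ℂ) → Matrix ι ι ℂ,
      (∀ i j, DifferentiableOn ℂ (fun z => F z i j) (ball 0 R)) →
      (∀ i j, DifferentiableOn ℂ (fun z => G z i j) (ball 0 R)) →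
      ∀ i j, DifferentiableOn ℂ (fun z => (F z * G z) i j) (ball 0 R) := by
    intro F G hF hG i j
    simp only [Matrix.mul_apply]
    exact DifferentiableOn.fun_sum fun k _ => (hF i k).mul (hG k j)
  refine ⟨R, hR, fun z hz => (hball hz).2, S, hS, fun z hz => ?_, ?_⟩
  · ext1 i j
    have hL := hmul S B hS hBR i j
    have hN := (hmul A S hAR hS i j).neg
    have hD : taylor ((fun z => (S z * B z) i j) + -fun z => (A z * S z) i j) = 0 := by
      have hsum : taylor ((fun z => (S z * B z) i j) + -fun z => (A z * S z) i j) +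
          taylor (fun z => (A z * S z) i j) = taylor (fun z => (S z * B z) i j) := by
        rw [← taylor_add ((hL.add hN).contDiffAt_real isOpen_ball (mem_ball_self hR))
          ((hmul A S hAR hS i j).contDiffAt_real isOpen_ball (mem_ball_self hR)),
          neg_add_cancel_right]
      rw [taylor_matrix_mul hS0 hB0, taylor_matrix_mul hA0 hS0, hStaylor, hHAB] at hsum
      exact add_eq_right.1 hsum
    have hz0 := eq_zero_of_taylor_eq_zero (hL.add hN) hD hz
    exact eq_of_sub_eq_zero ((sub_eq_add_neg _ _).trans hz0)
  · ext1 i j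
    exact (seriesSum_zero (H i j)).trans ((hH0 i j).trans (constantCoeff_taylor _))

end Spallek

/-- Spallek's criterion: a `C^∞` intertwiner of two holomorphic matrices can locally
be replaced by a holomorphic intertwiner with the same value at the given point. -/
theorem spallek_criterion (N n : ℕ) (Ω : Set (Fin N → ℂ)) (hΩ : IsOpen Ω)
    (A B : (Fin N → ℂ) → Matrix (Fin n) (Fin n) ℂ)
    (hA : MatHoloOn A Ω) (hB : MatHoloOn B Ω)
    (ξ : Fin N → ℂ) (hξ : ξ ∈ Ω)
    (Φ : Matrix (Fin n) (Fin n) ℂ)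
    (V : Set (Fin N → ℂ)) (hV : IsOpen V) (hξV : ξ ∈ V) (hVΩ : V ⊆ Ω)
    (T : (Fin N → ℂ) → Matrix (Fin n) (Fin n) ℂ)
    (hTsmooth : ∀ i j, ContDiffOn ℝ ((⊤ : ℕ∞) : WithTop ℕ∞) (fun ζ => T ζ i j) V)
    (hTint : ∀ ζ ∈ V, T ζ * B ζ = A ζ * T ζ)
    (hTξ : T ξ = Φ) :
    ∃ U : Set (Fin N → ℂ), IsOpen U ∧ ξ ∈ U ∧ U ⊆ V ∧
      ∃ H : (Fin N → ℂ) → Matrix (Fin n) (Fin n) ℂ, MatHoloOn H U ∧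
        (∀ ζ ∈ U, H ζ * B ζ = A ζ * H ζ) ∧ H ξ = Φ := by
  have hadd : Continuous fun z : Fin N → ℂ => ξ + z := by fun_prop
  have hmaps : Set.MapsTo (fun z => ξ + z) ((fun z => ξ + z) ⁻¹' V) V := fun _ hz => hz
  have h0 : (0 : Fin N → ℂ) ∈ (fun z => ξ + z) ⁻¹' V := by simpa using hξV
  have hdiff : ∀ s, DifferentiableOn ℂ (fun z : Fin N → ℂ => ξ + z) s := fun s => by fun_prop
  obtain ⟨R, hR, hRV, H, hH, hHAB, hH0⟩ := exists_holomorphic_intertwiner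
    (hV.preimage hadd) h0 (A := fun z => A (ξ + z)) (B := fun z => B (ξ + z))
    (T := fun z => T (ξ + z))
    (fun i j => ((hA i j).mono hVΩ).comp (hdiff _) hmaps)
    (fun i j => ((hB i j).mono hVΩ).comp (hdiff _) hmaps)
    (fun i j => by
      have h : ContDiffAt ℝ ((⊤ : ℕ∞) : WithTop ℕ∞) (fun ζ => T ζ i j) (ξ + 0) := by
        simpa using (hTsmooth i j).contDiffAt (hV.mem_nhds hξV)
      exact h.comp (0 : Fin N → ℂ) (contDiffAt_const.add contDiffAt_id))
    fun z hz => hTint _ hz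
  have hsub : ∀ ζ ∈ Metric.ball ξ R, ζ - ξ ∈ Metric.ball (0 : Fin N → ℂ) R := fun ζ hζ => by
    rwa [mem_ball_zero_iff, ← mem_ball_iff_norm]
  refine ⟨Metric.ball ξ R, Metric.isOpen_ball, Metric.mem_ball_self hR, fun ζ hζ => ?_,
    fun ζ => H (ζ - ξ), fun i j => ?_, fun ζ hζ => ?_, ?_⟩
  · simpa using hRV (hsub ζ hζ)
  · exact (hH i j).comp (by fun_prop) hsub
  · simpa using hHAB _ (hsub ζ hζ)
  · simpa [hTξ] using hH0
end

section
/- For every matrix Φ ∈ Mat(n×n, ℂ), the set GCom Φ := {Θ ∈ GL(n, ℂ) : Θ Φ = Φ Θ} of invertible complex n×n matrices commuting with Φ is path-connected. -/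
open Polynomial in
/-- The complex line through `A` and `B` contains only finitely many singular matrices,
as soon as `A` is invertible. -/
theorem finite_setOf_det_lineMap_eq_zero {n : ℕ} {A : Matrix (Fin n) (Fin n) ℂ}
    (hA : A.det ≠ 0) (B : Matrix (Fin n) (Fin n) ℂ) :
    {z : ℂ | (A + z • (B - A)).det = 0}.Finite := by
  let p : ℂ[X] := (A.map C + (X : ℂ[X]) • (B - A).map C).det
  have hp (z : ℂ) : p.eval z = (A + z • (B - A)).det := by
    rw [← coe_evalRingHom, RingHom.map_det]
    congr 1
    ext i j
    simp
  have hp0 : p ≠ 0 := fun h => hA (by simpa [h] using (hp 0).symm)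
  refine (finite_setOfPred_isRoot hp0).subset fun z hz => ?_
  exact (hp z).trans hz

/-- For every complex `n × n` matrix `Φ`, the set of invertible matrices commuting
with `Φ` is path-connected. -/
theorem gcom_pathConnected (n : ℕ) (Φ : Matrix (Fin n) (Fin n) ℂ) :
    IsPathConnected {Θ : Matrix (Fin n) (Fin n) ℂ | IsUnit Θ ∧ Θ * Φ = Φ * Θ} := by
  simp only [Matrix.isUnit_iff_isUnit_det, isUnit_iff_ne_zero]
  refine isPathConnected_iff.2 ⟨⟨1, by simp⟩, ?_⟩
  rintro A ⟨hA, hAΦ⟩ B ⟨hB, hBΦ⟩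
  have hS := (finite_setOf_det_lineMap_eq_zero hA B).countable.isPathConnected_compl_of_one_lt_rank
    (E := ℂ) (by simp [Complex.rank_real_complex])
  have hcont : Continuous fun z : ℂ => A + z • (B - A) := by fun_prop
  refine ((hS.image hcont).joinedIn A ⟨0, by simpa using hA, by simp⟩
    B ⟨1, by simpa using hB, by simp⟩).mono ?_
  rintro _ ⟨z, hz, rfl⟩
  exact ⟨hz, by simp [add_mul, mul_add, sub_mul, mul_sub, hAΦ, hBΦ]⟩
end

section
/- Let D ⊆ ℂ be a connected open set, let M : D → Mat(n×m, ℂ) be holomorphic with M not identically zero, and let ξ ∈ D. Then there exist an open neighborhood U ⊆ D of ξ, holomorphic maps E : U → GL(n, ℂ) and F : U → GL(m, ℂ), a natural number r, and nonnegative integers κ₁, …, κ_r such that for all ζ ∈ U, M(ζ) = E(ζ) · [[Δ(ζ), 0], [0, 0]] · F(ζ), where Δ(ζ) is the r×r diagonal matrix with diagonal entries (ζ−ξ)^{κ₁}, …, (ζ−ξ)^{κ_r} and [[Δ(ζ), 0], [0, 0]] denotes the n×m block matrix with Δ(ζ) in the upper left corner and zeros elsewhere. -/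
open Filter Topology

/-- The rectangular `n × m` matrix with diagonal entries `π ^ κ i` for `i < r` and zeros elsewhere. -/
def Matrix.powDiagonal {R : Type*} [CommRing R] (π : R) (n m : ℕ) {r : ℕ} (κ : Fin r → ℕ) :
    Matrix (Fin n) (Fin m) R :=
  Matrix.of fun i j =>
    if h : (i : ℕ) = (j : ℕ) ∧ (i : ℕ) < r then π ^ κ ⟨(i : ℕ), h.2⟩ else 0

theorem Matrix.powDiagonal_map {R S : Type*} [CommRing R] [CommRing S] (f : R →+* S) (π : R)
    (n m : ℕ) {r : ℕ} (κ : Fin r → ℕ) :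
    (powDiagonal π n m κ).map f = powDiagonal (f π) n m κ := by
  ext i j
  simp only [powDiagonal, Matrix.map_apply, Matrix.of_apply]
  split_ifs <;> simp

/-- `Fin (n + 1)` as a point followed by `Fin n`. -/
def Fin.unitSumEquiv (n : ℕ) : Unit ⊕ Fin n ≃ Fin (n + 1) :=
  (Equiv.sumComm _ _).trans ((Equiv.optionEquivSumPUnit (Fin n)).symm.trans
    (finSuccEquiv n).symm)

@[simp]
theorem Fin.unitSumEquiv_inl (n : ℕ) (x : Unit) : Fin.unitSumEquiv n (Sum.inl x) = 0 := by
  simp [Fin.unitSumEquiv]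

@[simp]
theorem Fin.unitSumEquiv_inr (n : ℕ) (i : Fin n) :
    Fin.unitSumEquiv n (Sum.inr i) = i.succ := by
  simp [Fin.unitSumEquiv]

theorem Matrix.powDiagonal_cons {R : Type*} [CommRing R] (π : R) (n m : ℕ) {r : ℕ} (k : ℕ)
    (κ : Fin r → ℕ) :
    (powDiagonal π (n + 1) (m + 1) (Fin.cons k κ : Fin (r + 1) → ℕ)).submatrix
      (Fin.unitSumEquiv n) (Fin.unitSumEquiv m) =
    fromBlocks (of fun _ _ => π ^ k) 0 0 (powDiagonal π n m κ) := by
  ext (i | i) (j | j)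
  · simp [powDiagonal]
  · simp [powDiagonal]
  · simp [powDiagonal]
  · simp only [powDiagonal, submatrix_apply, Fin.unitSumEquiv_inr, of_apply, fromBlocks_apply₂₂,
      Fin.val_succ, Nat.add_right_cancel_iff, Nat.add_lt_add_iff_right]
    split_ifs with h
    · congr 1
    · rfl

/-- If every element of `R` is zero or a unit times a power of `π`, then in every nonzero matrix
one can factor out a power of `π` so that a unit entry remains. -/
theorem Matrix.exists_eq_pow_smul {R : Type*} [CommRing R] {ι ι' : Type*} (π : R)
    (hπ : ∀ a : R, a = 0 ∨ ∃ (k : ℕ) (u : R), IsUnit u ∧ a = π ^ k * u)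
    (M : Matrix ι ι' R) (hM : M ≠ 0) :
    ∃ (k : ℕ) (N : Matrix ι ι' R) (i : ι) (j : ι'), M = π ^ k • N ∧ IsUnit (N i j) := by
  classical
  have hex : ∃ k i j u, IsUnit u ∧ M i j = π ^ k * u := by
    by_contra! h
    refine hM (Matrix.ext fun i j => (hπ (M i j)).resolve_right ?_)
    rintro ⟨k, u, hu, hk⟩
    exact h k i j u hu hk
  obtain ⟨i₀, j₀, u₀, hu₀, h₀⟩ := Nat.find_spec hex
  set k := Nat.find hex
  have hdvd : ∀ i j, ∃ b, M i j = π ^ k * b := by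
    intro i j
    rcases hπ (M i j) with h | ⟨l, u, hu, h⟩
    · exact ⟨0, by simp [h]⟩
    · obtain ⟨d, hd⟩ := Nat.exists_eq_add_of_le (Nat.find_min' hex ⟨i, j, u, hu, h⟩)
      exact ⟨π ^ d * u, by rw [h, hd, pow_add, mul_assoc]⟩
  choose b hb using hdvd
  refine ⟨k, Function.update b i₀ (Function.update (b i₀) j₀ u₀), i₀, j₀, ?_, by simpa⟩
  ext i j
  change M i j = π ^ k * Function.update b i₀ (Function.update (b i₀) j₀ u₀) i j
  by_cases hi : i = i₀
  · subst hi
    by_cases hj : j = j₀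
    · subst hj
      simp [h₀]
    · simp [hj, hb]
  · simp [hi, hb]

/-- Smith normal form over a ring in which every element is zero or a unit times a power of `π`. -/
theorem Matrix.exists_eq_mul_powDiagonal_mul {R : Type*} [CommRing R] (π : R)
    (hπ : ∀ a : R, a = 0 ∨ ∃ (k : ℕ) (u : R), IsUnit u ∧ a = π ^ k * u)
    (n m : ℕ) (M : Matrix (Fin n) (Fin m) R) :
    ∃ (E : Matrix (Fin n) (Fin n) R) (F : Matrix (Fin m) (Fin m) R) (r : ℕ) (κ : Fin r → ℕ),
      r ≤ n ∧ r ≤ m ∧ IsUnit E ∧ IsUnit F ∧ M = E * powDiagonal π n m κ * F := by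
  induction n generalizing m with
  | zero => exact ⟨1, 1, 0, Fin.elim0, by simp, by simp, isUnit_one, isUnit_one,
      by ext i; exact i.elim0⟩
  | succ n ih =>
    by_cases hM : M = 0
    · refine ⟨1, 1, 0, Fin.elim0, by simp, by simp, isUnit_one, isUnit_one, ?_⟩
      ext i j
      simp [hM, powDiagonal]
    obtain ⟨k, N, i₀, j₀, hMN, hu⟩ := exists_eq_pow_smul π hπ M hM
    cases m with
    | zero => exact j₀.elim0
    | succ m =>
      let e := Fin.unitSumEquiv n
      let e' := Fin.unitSumEquiv m
      let σ := e.trans (Equiv.swap 0 i₀)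
      let τ := e'.trans (Equiv.swap 0 j₀)
      let N' := N.submatrix σ τ
      have hA : IsUnit N'.toBlocks₁₁ := by
        rw [Matrix.isUnit_iff_isUnit_det, Matrix.det_unique]
        simpa [N', σ, τ, e, e', toBlocks₁₁] using hu
      obtain ⟨_⟩ := hA.nonempty_invertible
      obtain ⟨E, F, r, κ, hrn, hrm, hE, hF, hS⟩ :=
        ih m (π ^ k • (N'.toBlocks₂₂ - N'.toBlocks₂₁ * ⅟N'.toBlocks₁₁ * N'.toBlocks₁₂))
      let L : Matrix (Unit ⊕ Fin n) (Unit ⊕ Fin n) R :=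
        fromBlocks 1 0 (N'.toBlocks₂₁ * ⅟N'.toBlocks₁₁) 1 *
        fromBlocks N'.toBlocks₁₁ 0 0 E
      let V : Matrix (Unit ⊕ Fin m) (Unit ⊕ Fin m) R :=
        fromBlocks 1 0 0 F * fromBlocks 1 (⅟N'.toBlocks₁₁ * N'.toBlocks₁₂) 0 1
      have hL : IsUnit L := by
        refine IsUnit.mul ?_ ?_
        · simp
        · simp [hE, hA]
      have hV : IsUnit V := by
        refine IsUnit.mul ?_ ?_
        · simp [hF]
        · simp
      have hkey : M.submatrix σ τ =
          L * (powDiagonal π (n + 1) (m + 1) (Fin.cons k κ : Fin (r + 1) → ℕ)).submatrix e e' *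
            V := by
        have h1 : M.submatrix σ τ = π ^ k • N' := by rw [hMN]; rfl
        have h2 : π ^ k • (fromBlocks N'.toBlocks₁₁ 0 0
            (N'.toBlocks₂₂ - N'.toBlocks₂₁ * ⅟N'.toBlocks₁₁ * N'.toBlocks₁₂) :
              Matrix (Unit ⊕ Fin n) (Unit ⊕ Fin m) R) =
            (fromBlocks N'.toBlocks₁₁ 0 0 E : Matrix (Unit ⊕ Fin n) (Unit ⊕ Fin n) R) *
              (fromBlocks (of fun _ _ => π ^ k) 0 0 (powDiagonal π n m κ) :
                Matrix (Unit ⊕ Fin n) (Unit ⊕ Fin m) R) *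
              (fromBlocks 1 0 0 F : Matrix (Unit ⊕ Fin m) (Unit ⊕ Fin m) R) := by
          simp only [fromBlocks_multiply, fromBlocks_smul, hS, Matrix.mul_zero, Matrix.zero_mul,
            add_zero, zero_add, smul_zero, Matrix.mul_one]
          congr 1
          ext i j
          simp [Matrix.mul_apply, mul_comm]
        rw [h1, powDiagonal_cons, ← fromBlocks_toBlocks N',
          fromBlocks_eq_of_invertible₁₁, ← Matrix.smul_mul, ← Matrix.mul_smul, h2]
        simp only [L, V, Matrix.mul_assoc]
      refine ⟨L.submatrix σ.symm e.symm, V.submatrix e'.symm τ.symm, r + 1, Fin.cons k κ,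
        by lia, by lia, (isUnit_submatrix_equiv _ _).2 hL, (isUnit_submatrix_equiv _ _).2 hV, ?_⟩
      have h3 : M = (M.submatrix σ τ).submatrix σ.symm τ.symm := by simp
      rw [h3, hkey, ← submatrix_mul_equiv _ _ _ e'.symm, ← submatrix_mul_equiv _ _ _ e.symm]
      simp

/-- The ring of functions analytic at a point. -/
noncomputable def analyticSubring (ξ : ℂ) : Subring (ℂ → ℂ) where
  carrier := {f | AnalyticAt ℂ f ξ}
  mul_mem' := fun hf hg => hf.mul hg
  one_mem' := analyticAt_const
  add_mem' := fun hf hg => hf.add hg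
  zero_mem' := analyticAt_const
  neg_mem' := fun hf => hf.neg

/-- The homomorphism taking a function analytic at `ξ` to its germ. -/
noncomputable def analyticGerm (ξ : ℂ) : analyticSubring ξ →+* (𝓝 ξ).Germ ℂ :=
  (Germ.coeRingHom (𝓝 ξ)).comp (analyticSubring ξ).subtype

/-- Evaluation of a function analytic at `ξ` at a point. -/
noncomputable def analyticEval (ξ ζ : ℂ) : analyticSubring ξ →+* ℂ :=
  (Pi.evalRingHom (fun _ : ℂ => ℂ) ζ).comp (analyticSubring ξ).subtype

@[simp]
theorem analyticEval_apply (ξ ζ : ℂ) (f : analyticSubring ξ) :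
    analyticEval ξ ζ f = (f : ℂ → ℂ) ζ := rfl

theorem analyticGerm_eq_iff {ξ : ℂ} {f g : analyticSubring ξ} :
    (analyticGerm ξ).rangeRestrict f = (analyticGerm ξ).rangeRestrict g ↔
      (f : ℂ → ℂ) =ᶠ[𝓝 ξ] g :=
  Subtype.ext_iff.trans Germ.coe_eq

/-- The local coordinate `ζ - ξ`. -/
noncomputable def analyticCoord (ξ : ℂ) : analyticSubring ξ :=
  ⟨fun ζ => ζ - ξ, analyticAt_id.sub analyticAt_const⟩

theorem analyticGerm_eq_zero_or_eq_pow_mul (ξ : ℂ) (a : (analyticGerm ξ).range) :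
    a = 0 ∨ ∃ (k : ℕ) (u : (analyticGerm ξ).range), IsUnit u ∧
      a = (analyticGerm ξ).rangeRestrict (analyticCoord ξ) ^ k * u := by
  obtain ⟨f, rfl⟩ := (analyticGerm ξ).rangeRestrict_surjective a
  by_cases hf : ∀ᶠ z in 𝓝 ξ, (f : ℂ → ℂ) z = 0
  · left
    rw [← map_zero (analyticGerm ξ).rangeRestrict, analyticGerm_eq_iff]
    exact hf
  · right
    obtain ⟨k, g, hg, hg0, hfg⟩ :=
      (AnalyticAt.exists_eventuallyEq_pow_smul_nonzero_iff f.2).2 hf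
    let u : analyticSubring ξ := ⟨g, hg⟩
    let v : analyticSubring ξ := ⟨g⁻¹, hg.inv hg0⟩
    refine ⟨k, (analyticGerm ξ).rangeRestrict u, ?_, ?_⟩
    · refine IsUnit.of_mul_eq_one ((analyticGerm ξ).rangeRestrict v) ?_
      rw [← map_mul, ← map_one (analyticGerm ξ).rangeRestrict, analyticGerm_eq_iff]
      filter_upwards [hg.continuousAt.eventually_ne hg0] with z hz
      exact mul_inv_cancel₀ hz
    · rw [← map_pow, ← map_mul, analyticGerm_eq_iff]
      exact hfg

theorem eventually_map_analyticEval_eq {ξ : ℂ} {n m : ℕ}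
    {X Y : Matrix (Fin n) (Fin m) (analyticSubring ξ)}
    (h : X.map (analyticGerm ξ).rangeRestrict = Y.map (analyticGerm ξ).rangeRestrict) :
    ∀ᶠ ζ in 𝓝 ξ, X.map (analyticEval ξ ζ) = Y.map (analyticEval ξ ζ) := by
  have h' : ∀ i j, (X i j : ℂ → ℂ) =ᶠ[𝓝 ξ] Y i j := fun i j =>
    analyticGerm_eq_iff.1 (congrFun (congrFun h i) j)
  filter_upwards [eventually_all.2 fun i => eventually_all.2 (h' i)] with ζ hζ
  ext i j
  exact hζ i j

theorem exists_map_analyticGerm_eq {ξ : ℂ} {n m : ℕ}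
    (X : Matrix (Fin n) (Fin m) (analyticGerm ξ).range) :
    ∃ Y : Matrix (Fin n) (Fin m) (analyticSubring ξ),
      Y.map (analyticGerm ξ).rangeRestrict = X := by
  choose Y hY using fun i j => (analyticGerm ξ).rangeRestrict_surjective (X i j)
  exact ⟨Y, Matrix.ext hY⟩

theorem eventually_isUnit_map_analyticEval {ξ : ℂ} {n : ℕ}
    {X : Matrix (Fin n) (Fin n) (analyticSubring ξ)}
    (h : IsUnit (X.map (analyticGerm ξ).rangeRestrict)) :
    ∀ᶠ ζ in 𝓝 ξ, IsUnit (X.map (analyticEval ξ ζ)) := by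
  obtain ⟨Z, hZ⟩ := h.exists_right_inv
  obtain ⟨Y, rfl⟩ := exists_map_analyticGerm_eq Z
  have h1 : (X * Y).map (analyticGerm ξ).rangeRestrict =
      (1 : Matrix (Fin n) (Fin n) (analyticSubring ξ)).map (analyticGerm ξ).rangeRestrict := by
    rw [Matrix.map_mul, hZ, Matrix.map_one _ (map_zero _) (map_one _)]
  filter_upwards [eventually_map_analyticEval_eq h1] with ζ hζ
  rw [Matrix.map_mul, Matrix.map_one _ (map_zero _) (map_one _)] at hζ
  exact IsUnit.of_mul_eq_one _ hζ

theorem eventually_differentiableAt_entries {ξ : ℂ} {n m : ℕ}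
    (X : Matrix (Fin n) (Fin m) (analyticSubring ξ)) :
    ∀ᶠ ζ in 𝓝 ξ, ∀ i j, DifferentiableAt ℂ (X i j : ℂ → ℂ) ζ :=
  eventually_all.2 fun i => eventually_all.2 fun j =>
    (show AnalyticAt ℂ (X i j : ℂ → ℂ) ξ from (X i j).2).eventually_analyticAt.mono
      fun _ h => h.differentiableAt


/-- Local Smith factorization of a holomorphic matrix function of one variable:
`M(ζ) = E(ζ) · diag((ζ-ξ)^{κ₁},…,(ζ-ξ)^{κ_r}; 0) · F(ζ)` with `E`, `F` holomorphic
and invertible near `ξ`. -/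
theorem local_smith_factorization (n m : ℕ) (D : Set ℂ) (hD : IsOpen D)
    (hDconn : IsConnected D)
    (M : ℂ → Matrix (Fin n) (Fin m) ℂ) (hM : MatHoloOn M D)
    (hM0 : ¬ ∀ ζ ∈ D, M ζ = 0)
    (ξ : ℂ) (hξ : ξ ∈ D) :
    ∃ (U : Set ℂ), IsOpen U ∧ ξ ∈ U ∧ U ⊆ D ∧
      ∃ (E : ℂ → Matrix (Fin n) (Fin n) ℂ) (F : ℂ → Matrix (Fin m) (Fin m) ℂ)
        (r : ℕ) (_ : r ≤ n) (_ : r ≤ m) (κ : Fin r → ℕ),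
        MatHoloOn E U ∧ MatHoloOn F U ∧
        (∀ ζ ∈ U, IsUnit (E ζ) ∧ IsUnit (F ζ)) ∧
        ∀ ζ ∈ U, M ζ = E ζ *
          (Matrix.of fun (i : Fin n) (j : Fin m) =>
            if h : (i : ℕ) = (j : ℕ) ∧ (i : ℕ) < r then (ζ - ξ) ^ κ ⟨(i : ℕ), h.2⟩
            else 0) * F ζ := by
  let M₀ : Matrix (Fin n) (Fin m) (analyticSubring ξ) := fun i j =>
    ⟨fun ζ => M ζ i j, (hM i j).analyticAt (hD.mem_nhds hξ)⟩
  obtain ⟨E, F, r, κ, hrn, hrm, hE, hF, h⟩ :=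
    Matrix.exists_eq_mul_powDiagonal_mul _ (analyticGerm_eq_zero_or_eq_pow_mul ξ) n m
      (M₀.map (analyticGerm ξ).rangeRestrict)
  obtain ⟨E, rfl⟩ := exists_map_analyticGerm_eq E
  obtain ⟨F, rfl⟩ := exists_map_analyticGerm_eq F
  rw [← Matrix.powDiagonal_map, ← Matrix.map_mul, ← Matrix.map_mul] at h
  obtain ⟨U, hU, hUo, hξU⟩ := eventually_nhds_iff.1 <|
    (hD.eventually_mem hξ).and <| (eventually_map_analyticEval_eq h).and <|
    (eventually_isUnit_map_analyticEval hE).and <| (eventually_isUnit_map_analyticEval hF).and <|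
    (eventually_differentiableAt_entries E).and (eventually_differentiableAt_entries F)
  refine ⟨U, hUo, hξU, fun ζ hζ => (hU ζ hζ).1, fun ζ => E.map (analyticEval ξ ζ),
    fun ζ => F.map (analyticEval ξ ζ), r, hrn, hrm, κ,
    fun i j ζ hζ => ((hU ζ hζ).2.2.2.2.1 i j).differentiableWithinAt,
    fun i j ζ hζ => ((hU ζ hζ).2.2.2.2.2 i j).differentiableWithinAt,
    fun ζ hζ => ⟨(hU ζ hζ).2.2.1, (hU ζ hζ).2.2.2.1⟩, fun ζ hζ => ?_⟩
  have h' := (hU ζ hζ).2.1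
  rw [Matrix.map_mul, Matrix.map_mul, Matrix.powDiagonal_map] at h'
  exact h'
end

section
/- Let D ⊆ ℂ be a connected open set, let M : D → Mat(n×m, ℂ) be holomorphic with M not identically zero, and let ξ ∈ D. Let W ⊆ D be an open neighborhood of ξ and c : W → ℂ^m a continuous map with M(ζ) c(ζ) = 0 for all ζ ∈ W. Then there exist an open neighborhood V ⊆ W of ξ and a holomorphic map h : V → ℂ^m with M(ζ) h(ζ) = 0 for all ζ ∈ V and h(ξ) = c(ξ). -/
open Filter Topology in
/-- In a finite family of analytic germs that do not all vanish, one germ is nonzero and divides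
all the others. -/
theorem exists_analyticAt_dvd_family {ι : Type*} [Finite ι] {ξ : ℂ} {f : ι → ℂ → ℂ}
    (hf : ∀ j, AnalyticAt ℂ (f j) ξ) (hne : ∃ j, ¬ ∀ᶠ z in 𝓝 ξ, f j z = 0) :
    ∃ j₀, (∀ᶠ z in 𝓝[≠] ξ, f j₀ z ≠ 0) ∧ ∃ b : ι → ℂ → ℂ,
      (∀ j, AnalyticAt ℂ (b j) ξ) ∧ ∀ j, ∀ᶠ z in 𝓝 ξ, f j z = f j₀ z * b j z := by
  obtain ⟨j₁, hj₁⟩ := hne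
  have : Nonempty ι := ⟨j₁⟩
  obtain ⟨j₀, hmin⟩ := Finite.exists_min fun j => analyticOrderAt (f j) ξ
  have hfin : analyticOrderAt (f j₀) ξ ≠ ⊤ := fun htop =>
    hj₁ (analyticOrderAt_eq_top.1 (top_le_iff.1 (htop ▸ hmin j₁)))
  obtain ⟨k, hk⟩ := ENat.ne_top_iff_exists.1 hfin
  obtain ⟨u, hu, hu0, hfu⟩ := (hf j₀).analyticOrderAt_eq_natCast.1 hk.symm
  have hdiv : ∀ j, ∃ g : ℂ → ℂ, AnalyticAt ℂ g ξ ∧ ∀ᶠ z in 𝓝 ξ, f j z = (z - ξ) ^ k • g z :=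
    fun j => (natCast_le_analyticOrderAt (hf j)).1 (hk.le.trans (hmin j))
  choose g hg hfg using hdiv
  refine ⟨j₀, ?_, fun j z => g j z / u z, fun j => (hg j).div hu hu0, fun j => ?_⟩
  · refine (hf j₀).eventually_eq_zero_or_eventually_ne_zero.resolve_left fun h => ?_
    exact hfin (analyticOrderAt_eq_top.2 h)
  · filter_upwards [hfg j, hfu, hu.continuousAt.eventually_ne hu0] with z h1 h2 h3
    rw [h1, h2, smul_eq_mul, smul_eq_mul]
    field_simp

open Matrix Filter Topology in
/-- A continuous germ in the kernel of a matrix of analytic germs in one variable takes the same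
value at the base point as some analytic germ in the kernel. -/
theorem exists_analyticAt_kernel_section {ι : Type*} [Finite ι] {ξ : ℂ} (m : ℕ)
    (M : ℂ → Matrix ι (Fin m) ℂ) (hM : ∀ i j, AnalyticAt ℂ (fun z => M z i j) ξ)
    (c : ℂ → Fin m → ℂ) (hc : ContinuousAt c ξ) (hMc : ∀ᶠ z in 𝓝 ξ, M z *ᵥ c z = 0) :
    ∃ h : ℂ → Fin m → ℂ, AnalyticAt ℂ h ξ ∧ (∀ᶠ z in 𝓝 ξ, M z *ᵥ h z = 0) ∧ h ξ = c ξ := by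
  induction m with
  | zero =>
    exact ⟨fun _ => c ξ, analyticAt_const, by
      filter_upwards with z
      ext i
      simp [mulVec, dotProduct], rfl⟩
  | succ m ih =>
    by_cases hzero : ∀ i j, ∀ᶠ z in 𝓝 ξ, M z i j = 0
    · refine ⟨fun _ => c ξ, analyticAt_const, ?_, rfl⟩
      filter_upwards [eventually_all.2 fun i => eventually_all.2 (hzero i)] with z hz
      ext i
      simp [mulVec, dotProduct, hz]
    push Not at hzero
    obtain ⟨i₀, j₁, hj₁⟩ := hzero
    obtain ⟨j₀, hj₀, b, hb, hfb⟩ := exists_analyticAt_dvd_family (hM i₀) ⟨j₁, not_eventually.2 hj₁⟩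
    have hcj : ∀ j, ContinuousAt (fun z => c z j) ξ := continuousAt_pi.1 hc
    have hsum : ∀ᶠ z in 𝓝 ξ, c z j₀ = -∑ j, b (j₀.succAbove j) z * c z (j₀.succAbove j) := by
      have hcont : ContinuousAt
          (fun z => -∑ j, b (j₀.succAbove j) z * c z (j₀.succAbove j)) ξ :=
        (tendsto_finsetSum _ fun j _ => (hb _).continuousAt.mul (hcj _)).neg
      refine ((hcj j₀).eventuallyEq_nhds_iff_eventuallyEq_nhdsNE hcont).1 ?_
      filter_upwards [hj₀, hMc.filter_mono nhdsWithin_le_nhds,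
        (eventually_all.2 hfb).filter_mono nhdsWithin_le_nhds] with z h1 h2 h3
      have h4 : ∑ j, M z i₀ j * c z j = 0 := congrFun h2 i₀
      rw [Fin.sum_univ_succAbove _ j₀] at h4
      have h5 : ∑ j, M z i₀ (j₀.succAbove j) * c z (j₀.succAbove j)
          = M z i₀ j₀ * ∑ j, b (j₀.succAbove j) z * c z (j₀.succAbove j) := by
        rw [Finset.mul_sum]
        refine Finset.sum_congr rfl fun j _ => ?_
        rw [h3 (j₀.succAbove j), mul_assoc]
      rw [h5, ← mul_add] at h4
      exact eq_neg_of_add_eq_zero_left ((mul_eq_zero.1 h4).resolve_left h1)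
    -- Eliminating the pivot coordinate turns `M` into a matrix with one column fewer.
    have key : ∀ (z : ℂ) (i : ι) (v : Fin m → ℂ),
        ∑ j, (M z i (j₀.succAbove j) - M z i j₀ * b (j₀.succAbove j) z) * v j
          = M z i j₀ * (-∑ j, b (j₀.succAbove j) z * v j)
            + ∑ j, M z i (j₀.succAbove j) * v j := by
      intro z i v
      simp only [sub_mul, Finset.sum_sub_distrib, mul_neg, Finset.mul_sum, mul_assoc]
      ring
    obtain ⟨h, hh, hMh, hhc⟩ := ih
      (fun z => Matrix.of fun i j => M z i (j₀.succAbove j) - M z i j₀ * b (j₀.succAbove j) z)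
      (fun i j => (hM i _).sub ((hM i j₀).mul (hb _)))
      (fun z j => c z (j₀.succAbove j)) (continuousAt_pi.2 fun j => hcj _) (by
        filter_upwards [hMc, hsum] with z h1 h2
        ext i
        have h3 : ∑ j, M z i j * c z j = 0 := congrFun h1 i
        rw [Fin.sum_univ_succAbove _ j₀, h2] at h3
        exact (key z i _).trans h3)
    have hhj : ∀ j, AnalyticAt ℂ (fun z => h z j) ξ := analyticAt_pi_iff.1 hh
    refine ⟨fun z => j₀.insertNth (-∑ j, b (j₀.succAbove j) z * h z j) (h z), ?_, ?_, ?_⟩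
    · refine analyticAt_pi_iff.2 fun j => ?_
      rcases Fin.eq_self_or_eq_succAbove j₀ j with rfl | ⟨j, rfl⟩
      · simp only [Fin.insertNth_apply_same]
        exact (Finset.analyticAt_fun_sum _ fun j _ => (hb _).mul (hhj j)).neg
      · simpa only [Fin.insertNth_apply_succAbove] using hhj j
    · filter_upwards [hMh] with z h1
      ext i
      have h2 := (key z i (h z)).symm.trans (congrFun h1 i)
      simpa [mulVec, dotProduct, Fin.sum_univ_succAbove _ j₀] using h2
    · ext j
      rcases Fin.eq_self_or_eq_succAbove j₀ j with rfl | ⟨j, rfl⟩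
      · simp only [Fin.insertNth_apply_same, hhc]
        exact hsum.self_of_nhds.symm
      · simp only [Fin.insertNth_apply_succAbove, hhc]

open Matrix in
/-- A continuous solution of `M c = 0` in one variable can locally be replaced by a
holomorphic solution with the same value at the given point. -/
theorem continuous_kernel_section_holomorphic (n m : ℕ) (D : Set ℂ) (hD : IsOpen D)
    (hDconn : IsConnected D)
    (M : ℂ → Matrix (Fin n) (Fin m) ℂ) (hM : MatHoloOn M D)
    (hM0 : ¬ ∀ ζ ∈ D, M ζ = 0)
    (ξ : ℂ) (hξ : ξ ∈ D)
    (W : Set ℂ) (hW : IsOpen W) (hξW : ξ ∈ W) (hWD : W ⊆ D)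
    (c : ℂ → (Fin m → ℂ)) (hc : ContinuousOn c W)
    (hMc : ∀ ζ ∈ W, M ζ *ᵥ c ζ = 0) :
    ∃ V : Set ℂ, IsOpen V ∧ ξ ∈ V ∧ V ⊆ W ∧
      ∃ h : ℂ → (Fin m → ℂ), DifferentiableOn ℂ h V ∧
        (∀ ζ ∈ V, M ζ *ᵥ h ζ = 0) ∧ h ξ = c ξ := by
  obtain ⟨h, hh, hMh, hhξ⟩ := exists_analyticAt_kernel_section m M
    (fun i j => (hM i j).analyticAt (hD.mem_nhds hξ)) c (hc.continuousAt (hW.mem_nhds hξW))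
    (Filter.eventually_of_mem (hW.mem_nhds hξW) hMc)
  obtain ⟨V, hV, hVo, hξV⟩ := eventually_nhds_iff.1
    ((hh.eventually_analyticAt.and hMh).and (hW.eventually_mem hξW))
  exact ⟨V, hVo, hξV, fun z hz => (hV z hz).2, h,
    fun z hz => (hV z hz).1.1.differentiableAt.differentiableWithinAt,
    fun z hz => (hV z hz).1.2, hhξ⟩
end

section
/- Let Ω ⊆ ℂ^N be open, let M : Ω → Mat(n×m, ℂ) be holomorphic, and let ξ ∈ Ω be such that the dimension of ker M(ζ) (the kernel of M(ζ) as a linear map ℂ^m → ℂ^n) is equal to a constant r for all ζ in some neighborhood of ξ. Then there exist an open neighborhood U ⊆ Ω of ξ and holomorphic maps h₁, …, h_r : U → ℂ^m such that for every ζ ∈ U, the vectors h₁(ζ), …, h_r(ζ) form a basis of ker M(ζ); that is, the family {ker M(ζ)}_{ζ∈U} is a holomorphic sub-vector bundle of U × ℂ^m. -/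
/-- Every linear map between vector spaces has a generalized inverse. -/
theorem LinearMap.exists_comp_comp_eq_self {K E F : Type*} [Field K] [AddCommGroup E] [Module K E]
    [AddCommGroup F] [Module K F] (A : E →ₗ[K] F) : ∃ S : F →ₗ[K] E, ∀ x, A (S (A x)) = A x := by
  obtain ⟨g, hg⟩ := A.rangeRestrict.exists_rightInverse_of_surjective A.range_rangeRestrict
  obtain ⟨S, hS⟩ := g.exists_extend
  refine ⟨S, fun x => ?_⟩
  have h₁ : S (A x) = g (A.rangeRestrict x) := LinearMap.congr_fun hS (A.rangeRestrict x)
  have h₂ := congrArg Subtype.val (LinearMap.congr_fun hg (A.rangeRestrict x))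
  rw [h₁]
  exact h₂

/-- Kernels of constant dimension of a differentiable family of linear maps on a finite-dimensional
space locally admit a differentiable frame. -/
theorem DifferentiableOn.exists_frame_ker {𝕜 X E F : Type*} [NontriviallyNormedField 𝕜]
    [CompleteSpace 𝕜] [NormedAddCommGroup X] [NormedSpace 𝕜 X]
    [NormedAddCommGroup E] [NormedSpace 𝕜 E] [FiniteDimensional 𝕜 E]
    [NormedAddCommGroup F] [NormedSpace 𝕜 F] [FiniteDimensional 𝕜 F]
    {L : X → E →L[𝕜] F} {V : Set X} (hV : IsOpen V) (hL : DifferentiableOn 𝕜 L V)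
    {ξ : X} (hξ : ξ ∈ V) {r : ℕ}
    (hr : ∀ ζ ∈ V, Module.finrank 𝕜 (LinearMap.ker (L ζ : E →ₗ[𝕜] F)) = r) :
    ∃ U : Set X, IsOpen U ∧ ξ ∈ U ∧ U ⊆ V ∧ ∃ h : Fin r → X → E,
      (∀ i, DifferentiableOn 𝕜 (h i) U) ∧
      ∀ ζ ∈ U, LinearIndependent 𝕜 (fun i => h i ζ) ∧
        Submodule.span 𝕜 (Set.range fun i => h i ζ) = LinearMap.ker (L ζ : E →ₗ[𝕜] F) := by
  have : CompleteSpace E := FiniteDimensional.complete 𝕜 E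
  obtain ⟨S₀, hS₀⟩ := (L ξ : E →ₗ[𝕜] F).exists_comp_comp_eq_self
  let S : F →L[𝕜] E := LinearMap.toContinuousLinearMap S₀
  have hS : ∀ x, L ξ (S (L ξ x)) = L ξ x := hS₀
  let T : X → E →L[𝕜] E := fun ζ => 1 + S.comp (L ζ - L ξ)
  have hT_apply : ∀ ζ x, T ζ x = x + S (L ζ x - L ξ x) := fun ζ x => rfl
  have hT : DifferentiableOn 𝕜 T V :=
    ((differentiableOn_const S).clm_comp (hL.sub_const _)).const_add _
  let e := Module.finBasisOfFinrankEq 𝕜 _ (hr ξ hξ)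
  refine ⟨V ∩ T ⁻¹' {a | IsUnit a}, hT.continuousOn.isOpen_inter_preimage hV Units.isOpen,
    ⟨hξ, by simp [T]⟩, Set.inter_subset_left,
    fun i ζ => Ring.inverse (T ζ) (e i : E), fun i => ?_, ?_⟩
  · rintro ζ ⟨hζ, hu⟩
    obtain ⟨u, hu⟩ := hu
    have hinv : DifferentiableAt 𝕜 Ring.inverse (T ζ) := hu ▸ differentiableAt_inverse u.isUnit
    exact ((hinv.comp_differentiableWithinAt ζ (hT ζ hζ)).clm_apply
      (differentiableWithinAt_const _)).mono Set.inter_subset_left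
  · rintro ζ ⟨hζ, hu⟩
    have hleft : ∀ x, Ring.inverse (T ζ) (T ζ x) = x := fun x =>
      DFunLike.congr_fun (Ring.inverse_mul_cancel (T ζ) hu) x
    have hright : ∀ x, T ζ (Ring.inverse (T ζ) x) = x := fun x =>
      DFunLike.congr_fun (Ring.mul_inverse_cancel (T ζ) hu) x
    let R : E →ₗ[𝕜] E := (Ring.inverse (T ζ) : E →L[𝕜] E)
    have hR : LinearMap.ker R = ⊥ :=
      LinearMap.ker_eq_bot_of_injective (Function.LeftInverse.injective hright)
    have hli : LinearIndependent 𝕜 (fun i => Ring.inverse (T ζ) (e i : E)) :=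
      (e.linearIndependent.map' _ (Submodule.ker_subtype _)).map' R hR
    have hspan : Submodule.span 𝕜 (Set.range fun i => (e i : E)) =
        LinearMap.ker (L ξ : E →ₗ[𝕜] F) := by
      have h := congrArg (Submodule.map (Submodule.subtype _)) e.span_eq
      rwa [Submodule.map_span, ← Set.range_comp, Submodule.map_subtype_top] at h
    have hmap : Submodule.span 𝕜 (Set.range fun i => Ring.inverse (T ζ) (e i : E)) =
        (LinearMap.ker (L ξ : E →ₗ[𝕜] F)).map R := by
      have h := congrArg (Submodule.map R) hspan
      rwa [Submodule.map_span, ← Set.range_comp] at h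
    refine ⟨hli, (Submodule.eq_of_le_of_finrank_eq ?_ ?_).symm⟩
    · intro v hv
      have hv : L ζ v = 0 := hv
      rw [hmap]
      refine ⟨T ζ v, ?_, hleft v⟩
      change L ξ (T ζ v) = 0
      rw [hT_apply, hv, zero_sub, map_neg, map_add, map_neg, hS, add_neg_cancel]
    · rw [hr ζ hζ, finrank_span_eq_card hli, Fintype.card_fin]


/-- If the kernel of `M(ζ)` has constant dimension `r` near `ξ`, then near `ξ` the
kernels form a holomorphic sub-vector bundle: there are holomorphic maps
`h₁,…,h_r` whose values at each point form a basis of the kernel. -/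
theorem kernel_holomorphic_subbundle (N n m : ℕ) (Ω : Set (Fin N → ℂ)) (hΩ : IsOpen Ω)
    (M : (Fin N → ℂ) → Matrix (Fin n) (Fin m) ℂ) (hM : MatHoloOn M Ω)
    (ξ : Fin N → ℂ) (hξ : ξ ∈ Ω) (r : ℕ)
    (hconst : ∃ V : Set (Fin N → ℂ), IsOpen V ∧ ξ ∈ V ∧ V ⊆ Ω ∧
      ∀ ζ ∈ V, Module.finrank ℂ (LinearMap.ker (M ζ).mulVecLin) = r) :
    ∃ U : Set (Fin N → ℂ), IsOpen U ∧ ξ ∈ U ∧ U ⊆ Ω ∧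
      ∃ h : Fin r → (Fin N → ℂ) → (Fin m → ℂ),
        (∀ i, DifferentiableOn ℂ (h i) U) ∧
        ∀ ζ ∈ U, LinearIndependent ℂ (fun i => h i ζ) ∧
          Submodule.span ℂ (Set.range fun i => h i ζ) =
            LinearMap.ker (M ζ).mulVecLin := by
  obtain ⟨V, hV, hξV, hVΩ, hr⟩ := hconst
  let Φ : (Fin n → Fin m → ℂ) →ₗ[ℂ] ((Fin m → ℂ) →L[ℂ] (Fin n → ℂ)) :=
    (Matrix.toLin'.trans LinearMap.toContinuousLinearMap).toLinearMap
  have hΦ : DifferentiableOn ℂ (fun ζ => Φ (M ζ)) V :=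
    (LinearMap.toContinuousLinearMap Φ).differentiable.comp_differentiableOn
      (differentiableOn_pi.2 fun i => differentiableOn_pi.2 fun j => (hM i j).mono hVΩ)
  obtain ⟨U, hU, hξU, hUV, hh⟩ := hΦ.exists_frame_ker hV hξV hr
  exact ⟨U, hU, hξU, hUV.trans hVΩ, hh⟩
end
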